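/- Asymptotically almost every tautology is a simple tautology: for every n the quantities P_n(True) and μ_n(S_n) exist, and P_n(True) − μ_n(S_n) → 0 as n → ∞. -/

import Mathlib

/-- An and/or tree skeleton: leaves carry a variable index and a polarity
(`true` = positive literal, `false` = negated literal); internal nodes carry
a connective (`true` = AND, `false` = OR) and a list of children. -/
inductive AT (n : ℕ) : Type
  | leaf : Fin n → Bool → AT n
  | node : Bool → List (AT n) → AT n

namespace AT

/-- The connective at the root, if the root is an internal node. -/
def rootConn {n : ℕ} : AT n → Option Bool
  | .leaf _ _ => none
  | .node c _ => some c

/-- Whether a tree is a single leaf. -/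
def isLeafB {n : ℕ} : AT n → Bool
  | .leaf _ _ => true
  | .node _ _ => false

/-- The children of the root. -/
def rootChildren {n : ℕ} : AT n → List (AT n)
  | .leaf _ _ => []
  | .node _ ts => ts

/-- Well-formedness: an associative tree is a plane tree in which each internal
node has at least two children, no internal node has the same connective as its
parent (stratification), and leaves carry literals. -/
inductive WF {n : ℕ} : AT n → Prop
  | leaf (i : Fin n) (b : Bool) : WF (.leaf i b)
  | node (c : Bool) (ts : List (AT n)) :
      2 ≤ ts.length → (∀ t ∈ ts, WF t) → (∀ t ∈ ts, rootConn t ≠ some c) →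
      WF (.node c ts)

mutual
/-- The size of a tree: its total number of nodes. -/
def size {n : ℕ} : AT n → ℕ
  | .leaf _ _ => 1
  | .node _ ts => 1 + sizeList ts
def sizeList {n : ℕ} : List (AT n) → ℕ
  | [] => 0
  | t :: ts => size t + sizeList ts
end

mutual
/-- The Boolean function computed by a tree. -/
def eval {n : ℕ} : AT n → (Fin n → Bool) → Bool
  | .leaf i b, x => if b then x i else ! x i
  | .node c ts, x => evalList c ts x
def evalList {n : ℕ} : Bool → List (AT n) → (Fin n → Bool) → Bool
  | c, [], _ => c
  | c, t :: ts, x => if c then eval t x && evalList c ts x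
                     else eval t x || evalList c ts x
end

end AT

open AT

/-- Number of associative trees of size `m` in a family `𝒯`. -/
noncomputable def countIn (n : ℕ) (𝒯 : Set (AT n)) (m : ℕ) : ℕ :=
  Nat.card {t : AT n // t ∈ 𝒯 ∧ WF t ∧ size t = m}

/-- `A n m` is the number of associative trees of size `m` on `n` variables. -/
noncomputable def A (n m : ℕ) : ℕ := countIn n Set.univ m

/-- `Pmn n m f` is the proportion, among associative trees of size `m` on `n`
variables, of those computing the Boolean function `f`. -/
noncomputable def Pmn (n m : ℕ) (f : (Fin n → Bool) → Bool) : ℝ :=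
  (countIn n {t | eval t = f} m : ℝ) / (A n m : ℝ)

/-- Ratio of trees of size `m` in the family `𝒯` among all trees of size `m`. -/
noncomputable def ratio (n : ℕ) (𝒯 : Set (AT n)) (m : ℕ) : ℝ :=
  (countIn n 𝒯 m : ℝ) / (A n m : ℝ)

/-- `HasLimRatio n 𝒯 μ` : the limiting ratio of the family `𝒯` exists and is `μ`. -/
def HasLimRatio (n : ℕ) (𝒯 : Set (AT n)) (μ : ℝ) : Prop :=
  Filter.Tendsto (ratio n 𝒯) Filter.atTop (nhds μ)

/-- Extension of a Boolean function of `n₀` variables to `n ≥ n₀` variables. -/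
def extend {n₀ n : ℕ} (h : n₀ ≤ n) (f : (Fin n₀ → Bool) → Bool) :
    (Fin n → Bool) → Bool :=
  fun x => f (fun j => x (Fin.castLE h j))

open Classical in
/-- The tree size complexity of a Boolean function. -/
noncomputable def Lcomp (n : ℕ) (f : (Fin n → Bool) → Bool) : ℕ :=
  if f = (fun _ => true) ∨ f = (fun _ => false) then 0
  else if ∃ i : Fin n, f = (fun x => x i) ∨ f = (fun x => ! x i) then 2
  else sInf {m | ∃ t : AT n, WF t ∧ size t = m ∧ eval t = f}

/-- The set `S_n` of simple tautologies: `∨`-rooted associative trees with, for some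
variable `x`, both a leaf labelled `x` and a leaf labelled `x̄` among the children
of the root. -/
def SimpleTauto (n : ℕ) : Set (AT n) :=
  {t | rootConn t = some false ∧
    ∃ i : Fin n, AT.leaf i true ∈ rootChildren t ∧ AT.leaf i false ∈ rootChildren t}

section part1

open Filter Topology

/-- Ratio limit property. -/
def RL (u : ℕ → ℝ) : Prop :=
  (∀ᶠ m in atTop, u m ≠ 0) ∧ Tendsto (fun m => u (m+1) / u m) atTop (𝓝 1)

lemma RL.bound {u : ℕ → ℝ} (hu : RL u) {r : ℝ} (hr : 1 < r) :
    ∃ C M, ∀ m ≥ M, ∀ j ≤ m, |u (m - j)| ≤ C * r ^ j * |u m| := by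
  obtain ⟨h0, h1⟩ := hu
  have h2 : Tendsto (fun m => |u (m+1) / u m|⁻¹) atTop (𝓝 1) := by
    have := (h1.abs).inv₀ (by simp)
    simpa using this
  have h3 : ∀ᶠ m in atTop, |u (m+1) / u m|⁻¹ < r := h2.eventually_lt_const hr
  obtain ⟨M, hM⟩ := eventually_atTop.1 (h0.and h3)
  have hr0 : 0 < r := by linarith
  have step : ∀ m ≥ M, |u m| ≤ r * |u (m+1)| := by
    intro m hm
    have a := (hM m hm).1
    have b := (hM (m+1) (by omega)).1
    have c := (hM m hm).2
    rw [abs_div, inv_div, div_lt_iff₀ (abs_pos.2 b)] at c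
    exact c.le
  have steps : ∀ k, ∀ m ≥ M, |u m| ≤ r ^ k * |u (m+k)| := by
    intro k
    induction k with
    | zero => intro m _; simp
    | succ k ih =>
      intro m hm
      calc |u m| ≤ r ^ k * |u (m+k)| := ih m hm
        _ ≤ r ^ k * (r * |u (m+k+1)|) := by
          gcongr; exact step _ (by omega)
        _ = r ^ (k+1) * |u (m + (k+1))| := by rw [pow_succ]; ring_nf
  have hMpos : 0 < |u M| := abs_pos.2 (hM M le_rfl).1
  set C' := ∑ i ∈ Finset.range M, |u i| / |u M| with hC'
  have hC'0 : 0 ≤ C' := Finset.sum_nonneg fun i _ => by positivity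
  refine ⟨1 + C', M, fun m hm j hj => ?_⟩
  have hx : 0 ≤ r ^ j * |u m| := by positivity
  by_cases hi : M ≤ m - j
  · have := steps j (m - j) hi
    rw [Nat.sub_add_cancel hj] at this
    nlinarith
  · push Not at hi
    have h4 : |u (m-j)| / |u M| ≤ C' :=
      Finset.single_le_sum (f := fun i => |u i| / |u M|) (fun i _ => by positivity)
        (Finset.mem_range.2 hi)
    rw [div_le_iff₀ hMpos] at h4
    have h5 := steps (m - M) M le_rfl
    rw [Nat.add_sub_cancel' hm] at h5
    have h6 : r ^ (m - M) ≤ r ^ j := pow_le_pow_right₀ hr.le (by omega)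
    have h7 : |u M| ≤ r ^ j * |u m| := h5.trans (by gcongr)
    nlinarith

lemma RL.shift {u : ℕ → ℝ} (hu : RL u) (j : ℕ) :
    Tendsto (fun m => u (m - j) / u m) atTop (𝓝 1) := by
  obtain ⟨h0, h1⟩ := hu
  suffices h : Tendsto (fun m => u m / u (m + j)) atTop (𝓝 1) by
    rw [← tendsto_add_atTop_iff_nat j]
    simpa using h
  induction j with
  | zero =>
    apply tendsto_const_nhds.congr'
    filter_upwards [h0] with m hm
    simp [hm]
  | succ j ih =>
    have h2 := (h1.comp (tendsto_add_atTop_nat j)).inv₀ one_ne_zero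
    have h3 := ih.mul h2
    simp only [inv_one, mul_one] at h3
    refine h3.congr' ?_
    filter_upwards [(tendsto_add_atTop_nat j).eventually h0] with m hm
    simp only [Function.comp, inv_div]
    rw [div_mul_div_cancel₀ hm, add_assoc]

/-- convolution -/
noncomputable def cv (u v : ℕ → ℝ) (m : ℕ) : ℝ :=
  ∑ p ∈ Finset.HasAntidiagonal.antidiagonal m, u p.1 * v p.2

lemma cv_tendsto {u v : ℕ → ℝ} (hu : RL u) {r : ℝ} (hr : 1 < r)
    (hv : Summable fun j => |v j| * r ^ j) :
    Tendsto (fun m => cv u v m / u m) atTop (𝓝 (∑' j, v j)) := by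
  obtain ⟨C, M, hb⟩ := hu.bound hr
  have key : ∀ m, cv u v m / u m = ∑' j, if j ≤ m then u (m - j) / u m * v j else 0 := by
    intro m
    rw [tsum_eq_sum (s := Finset.range (m+1)) (by
      intro j hj; rw [Finset.mem_range] at hj; rw [if_neg (by omega)])]
    rw [cv, Finset.Nat.sum_antidiagonal_eq_sum_range_succ_mk, ← Finset.sum_range_reflect,
      Finset.sum_div]
    apply Finset.sum_congr rfl
    intro j hj
    rw [Finset.mem_range] at hj
    rw [if_pos (by omega)]
    have : m - (m + 1 - 1 - j) = j := by omega
    simp only [this]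
    have : m + 1 - 1 - j = m - j := by omega
    rw [this]; ring
  simp_rw [key]
  refine tendsto_tsum_of_dominated_convergence (bound := fun j => |C| * (|v j| * r ^ j))
    (hv.mul_left _) ?_ ?_
  · intro j
    have h := (hu.shift j).mul_const (v j)
    rw [one_mul] at h
    refine h.congr' ?_
    filter_upwards [eventually_ge_atTop j] with m hm
    rw [if_pos hm]
  · filter_upwards [hu.1, eventually_ge_atTop M] with m hm hmM j
    have hp : 0 ≤ |C| * (|v j| * r ^ j) := by positivity
    split_ifs with h
    · have h1 := hb m hmM j h
      have h2 : |u (m-j) / u m| ≤ |C| * r ^ j := by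
        rw [abs_div, div_le_iff₀ (abs_pos.2 hm)]
        refine h1.trans ?_
        gcongr
        exact le_abs_self C
      rw [Real.norm_eq_abs, abs_mul]
      calc _ ≤ (|C| * r ^ j) * |v j| := by gcongr
        _ = _ := by ring
    · simpa using hp

lemma RL.of_equiv {u w : ℕ → ℝ} (hu : RL u) {L : ℝ} (hL : L ≠ 0)
    (h : Tendsto (fun m => w m / u m) atTop (𝓝 L)) : RL w := by
  have hw : ∀ᶠ m in atTop, w m ≠ 0 := by
    filter_upwards [h.eventually_ne hL] with m hm h0
    simp [h0] at hm
  refine ⟨hw, ?_⟩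
  have h1 := ((h.comp (tendsto_add_atTop_nat 1)).mul hu.2).div h hL
  simp only [mul_one, div_self hL] at h1
  refine h1.congr' ?_
  filter_upwards [hu.1, hw, (tendsto_add_atTop_nat 1).eventually hu.1] with m a b c
  simp only [Function.comp, Pi.div_apply] at *
  field_simp

lemma RL.cv {u v : ℕ → ℝ} (hu : RL u) {r : ℝ} (hr : 1 < r)
    (hv : Summable fun j => |v j| * r ^ j) (h0 : ∑' j, v j ≠ 0) : RL (cv u v) :=
  hu.of_equiv h0 (cv_tendsto hu hr hv)

lemma RL.congr' {u w : ℕ → ℝ} (hu : RL u) (h : ∀ᶠ m in atTop, w m = u m) : RL w := by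
  refine hu.of_equiv one_ne_zero ?_
  apply tendsto_const_nhds.congr'
  filter_upwards [h, hu.1] with m a b
  rw [a, div_self b]

/-- coefficients of `sqrt (1 - x)` -/
noncomputable def sqc : ℕ → ℝ
  | 0 => 1
  | m + 1 => sqc m * (2 * m - 1) / (2 * m + 2)

lemma sqc_neg (m : ℕ) : sqc (m+1) < 0 := by
  induction m with
  | zero => norm_num [sqc]
  | succ m ih =>
    rw [sqc]
    apply div_neg_of_neg_of_pos
    · apply mul_neg_of_neg_of_pos ih
      push_cast
      have : (0:ℝ) ≤ m := by positivity
      linarith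
    · positivity

lemma sqc_ne (m : ℕ) : sqc m ≠ 0 := by
  cases m with
  | zero => simp [sqc]
  | succ m => exact (sqc_neg m).ne

lemma sqc_RL : RL sqc := by
  refine ⟨Eventually.of_forall sqc_ne, ?_⟩
  have : ∀ m : ℕ, sqc (m+1) / sqc m = 1 - (3/2) * (1 / ((m:ℝ) + 1)) := by
    intro m
    rw [sqc]
    have := sqc_ne m
    have h : (m:ℝ) + 1 ≠ 0 := by positivity
    have h : 2 * (m:ℝ) + 2 ≠ 0 := by positivity
    field_simp
    ring
  simp_rw [this]
  have h := (tendsto_one_div_add_atTop_nhds_zero_nat (𝕜 := ℝ)).const_mul (3/2)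
  simpa using h.const_sub 1

lemma sqc_partial (K : ℕ) : ∑ m ∈ Finset.range (K+1), sqc m = - 2 * (K + 1) * sqc (K+1) := by
  induction K with
  | zero => norm_num [sqc]
  | succ K ih =>
    rw [Finset.sum_range_succ, ih]
    conv_rhs => rw [sqc]
    push_cast
    have h : 2 * ((K:ℝ)+1) + 2 ≠ 0 := by positivity
    field_simp
    ring

lemma sqc_summable : Summable fun m => |sqc m| := by
  rw [← summable_nat_add_iff 1]
  refine summable_of_sum_range_le (c := 1) (fun _ => abs_nonneg _) ?_
  intro K
  have h1 : ∑ i ∈ Finset.range K, |sqc (i+1)| = - ∑ i ∈ Finset.range K, sqc (i+1) := by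
    rw [← Finset.sum_neg_distrib]
    exact Finset.sum_congr rfl fun i _ => abs_of_neg (sqc_neg i)
  have h2 := sqc_partial K
  rw [Finset.sum_range_succ'] at h2
  have h3 : sqc 0 = 1 := rfl
  have h4 : 0 ≤ -2 * ((K:ℝ)+1) * sqc (K+1) := by
    have := sqc_neg K
    have : (0:ℝ) ≤ (K+1) := by positivity
    nlinarith
  rw [h1]; linarith

lemma sqc_abs_le (m : ℕ) : |sqc m| ≤ 1 := by
  induction m with
  | zero => simp [sqc]
  | succ m ih =>
    rw [sqc, abs_div, abs_mul]
    have h : |2 * (m:ℝ) - 1| ≤ 2 * m + 2 := by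
      have : (0:ℝ) ≤ m := by positivity
      rw [abs_le]; constructor <;> linarith
    have h2 : |2 * (m:ℝ) + 2| = 2 * m + 2 := abs_of_nonneg (by positivity)
    rw [h2, div_le_one (by positivity)]
    nlinarith [abs_nonneg (sqc m), abs_nonneg (2 * (m:ℝ) - 1)]

open PowerSeries in
lemma sqc_mul : (mk sqc : PowerSeries ℝ) * mk sqc = 1 - X := by
  set S : PowerSeries ℝ := mk sqc with hS
  have ode : (1 - X) * (d⁄dX ℝ S) = - C (1/2 : ℝ) * S := by
    ext m
    have e2 : coeff m (-C (1/2:ℝ) * S) = - (1/2) * sqc m := by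
      rw [show -C (1/2:ℝ) * S = C (-(1/2) : ℝ) * S by simp, coeff_C_mul, hS, coeff_mk]
    rw [sub_mul, one_mul, map_sub, e2]
    cases m with
    | zero =>
      simp [coeff_derivative, hS, sqc]; norm_num
    | succ m =>
      rw [coeff_succ_X_mul, coeff_derivative, coeff_derivative, hS, coeff_mk, coeff_mk]
      conv_lhs => enter [1]; rw [sqc]
      push_cast
      have h : 2 * ((m:ℝ)+1) + 2 ≠ 0 := by positivity
      field_simp
      ring
  set F := S * S with hF
  have ode2 : (1 - X) * (d⁄dX ℝ F) = - F := by
    rw [hF, Derivation.leibniz, smul_eq_mul, mul_add]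
    have : (1 - X) * (S * (d⁄dX ℝ S)) = S * ((1 - X) * (d⁄dX ℝ S)) := by ring
    rw [this, ode]
    have h2 : (C (1/2:ℝ) : PowerSeries ℝ) + C (1/2:ℝ) = 1 := by
      rw [← map_add]; norm_num
    linear_combination (-S * S) * h2
  have hrec : ∀ m : ℕ, ((m:ℝ)+1) * coeff (m+1) F = ((m:ℝ) - 1) * coeff m F := by
    intro m
    have := congrArg (coeff m) ode2
    rw [sub_mul, one_mul, map_sub, map_neg] at this
    cases m with
    | zero =>
      simp only [coeff_derivative, coeff_zero_X_mul] at this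
      push_cast at *
      linarith
    | succ m =>
      rw [coeff_succ_X_mul, coeff_derivative, coeff_derivative] at this
      push_cast at *
      linarith
  have f0 : coeff 0 F = 1 := by
    simp [hF, hS, sqc, coeff_zero_eq_constantCoeff]
  have f1 : coeff 1 F = -1 := by
    have := hrec 0; simp [f0] at this; simpa using this
  have f2 : ∀ m, coeff (m+2) F = 0 := by
    intro m
    induction m with
    | zero => have := hrec 1; simp at this; linarith
    | succ m ih =>
      have := hrec (m+2)
      rw [ih, mul_zero] at this
      have h : ((m+2:ℕ):ℝ) + 1 ≠ 0 := by positivity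
      exact (mul_eq_zero.1 this).resolve_left h
  ext m
  match m with
  | 0 => rw [f0]; simp
  | 1 => rw [f1]; simp [coeff_one, coeff_X]
  | m+2 => rw [f2]; simp [coeff_one, coeff_X]


end part1

section part2

open Filter Topology

open PowerSeries in
lemma cv_coeff (P Q : PowerSeries ℝ) :
    (fun m => coeff m (P * Q)) = cv (fun m => coeff m P) (fun m => coeff m Q) := by
  funext m; rw [coeff_mul]; rfl

lemma cv_summable {u v : ℕ → ℝ} (hu : Summable fun m => |u m|) (hv : Summable fun m => |v m|) :
    Summable fun m => |cv u v m| := by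
  have h := summable_norm_sum_mul_antidiagonal_of_summable_norm (f := u) (g := v) hu hv
  simp only [Real.norm_eq_abs] at h
  exact h

lemma cv_tsum {u v : ℕ → ℝ} (hu : Summable fun m => |u m|) (hv : Summable fun m => |v m|) :
    (∑' m, u m) * (∑' m, v m) = ∑' m, cv u v m :=
  tsum_mul_tsum_eq_tsum_sum_antidiagonal_of_summable_norm hu hv

lemma geo_r {a : ℝ} (ha : |a| < 1) : ∃ r : ℝ, 1 < r ∧ |a| * r < 1 := by
  have h0 := abs_nonneg a
  refine ⟨2 / (1 + |a|), ?_, ?_⟩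
  · rw [lt_div_iff₀ (by positivity)]; linarith
  · rw [mul_div_assoc', div_lt_one (by positivity)]; linarith

lemma geo_summable {a r : ℝ} (v : ℕ → ℝ) (hv : ∀ j, |v j| ≤ |a| ^ j) (hr : 1 < r)
    (har : |a| * r < 1) : Summable fun j => |v j| * r ^ j := by
  have h0 := abs_nonneg a
  refine Summable.of_nonneg_of_le (fun j => by positivity) (fun j => ?_)
    (summable_geometric_of_lt_one (r := |a| * r) (by positivity) har)
  rw [mul_pow]
  gcongr
  exact hv j

lemma geo_summable' {a : ℝ} (v : ℕ → ℝ) (hv : ∀ j, |v j| ≤ |a| ^ j) (ha : |a| < 1) :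
    Summable fun j => |v j| :=
  Summable.of_nonneg_of_le (fun j => by positivity) hv
    (summable_geometric_of_lt_one (abs_nonneg a) ha)

open PowerSeries in
theorem main_an (B : PowerSeries ℝ) (c ρ θ : ℝ) (h0 : constantCoeff B = 0)
    (hB : B * (1 - B) = C c * X * (1 - B) + C ρ * X * B ^ 2)
    (h1 : 1 + θ = 2 * c) (h2 : θ = c ^ 2 - 4 * ρ * c) (hθ : |θ| < 1) (hρ : |ρ| < 1) :
    RL (fun m => coeff m B) ∧ Summable (fun m => |coeff m B|) := by
  set U : PowerSeries ℝ := mk sqc with hU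
  set V : PowerSeries ℝ := rescale θ U with hV
  have hV2 : V * V = 1 - C θ * X := by
    rw [hV, ← map_mul, hU, sqc_mul, map_sub, map_one, rescale_X]
  set G : PowerSeries ℝ := 1 + C c * X - 2 * (1 + C ρ * X) * B with hG
  have c1 : (1 : PowerSeries ℝ) + C θ = 2 * C c := by
    rw [← map_ofNat (C : ℝ →+* PowerSeries ℝ) 2, ← map_mul, ← h1, map_add, map_one]
  have c2 : (C θ : PowerSeries ℝ) = C c ^ 2 - 4 * C ρ * C c := by
    rw [← map_ofNat (C : ℝ →+* PowerSeries ℝ) 4, ← map_mul, ← map_mul, ← map_pow, ← map_sub, ← h2]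
  have hG2 : G ^ 2 = (U * V) ^ 2 := by
    have : (U * V) ^ 2 = (1 - X) * (1 - C θ * X) := by
      rw [← hV2, ← sqc_mul]; ring
    rw [this, hG]
    linear_combination (-4 * (1 + C ρ * X)) * hB + X * c1 - X^2 * c2
  have hUV : G = U * V := by
    rcases sq_eq_sq_iff_eq_or_eq_neg.1 hG2 with h | h
    · exact h
    · exfalso
      have := congrArg (constantCoeff (R := ℝ)) h
      have hv : constantCoeff V = 1 := by
        rw [hV, ← coeff_zero_eq_constantCoeff_apply, coeff_rescale]
        simp [hU, sqc]
      have hu : constantCoeff U = 1 := by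
        simp [hU, sqc]
      simp [hG, h0, hv, hu] at this
      norm_num at this
  set E : PowerSeries ℝ := mk (fun j => (-ρ) ^ j) with hE
  have hE1 : (1 + C ρ * X) * E = 1 := by
    ext m
    rw [add_mul, one_mul, map_add, mul_assoc, coeff_C_mul]
    cases m with
    | zero => simp [hE]
    | succ m => rw [coeff_succ_X_mul, hE, coeff_mk, coeff_mk]; simp [coeff_one, pow_succ]; ring
  set P : PowerSeries ℝ := C (1/2) * (1 + C c * X - U * V) with hP
  have hBP : B = P * E := by
    have h3 : (C (1/2:ℝ) : PowerSeries ℝ) * 2 = 1 := by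
      rw [← map_ofNat (C : ℝ →+* PowerSeries ℝ) 2, ← map_mul]; norm_num
    rw [hP, ← hUV, hG]
    linear_combination (-B) * hE1 - (B * (1 + C ρ * X) * E) * h3
  -- sequences
  have vle : ∀ j, |coeff j V| ≤ |θ| ^ j := by
    intro j
    rw [hV, coeff_rescale, abs_mul, abs_pow, hU, coeff_mk]
    exact mul_le_of_le_one_right (by positivity) (sqc_abs_le j)
  have ele : ∀ j, |coeff j E| ≤ |ρ| ^ j := by
    intro j
    rw [hE, coeff_mk, abs_pow, abs_neg]
  have vsum := geo_summable' _ vle hθ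
  have esum := geo_summable' _ ele hρ
  have usum : Summable fun j => |coeff j U| := by simpa [hU] using sqc_summable
  have URL : RL (fun j => coeff j U) := by simpa [hU] using sqc_RL
  have vne : ∑' j, coeff j V ≠ 0 := by
    intro h
    have := cv_tsum vsum vsum
    rw [← cv_coeff, hV2, h] at this
    have h4 : ∑' m, coeff m (1 - C θ * X : PowerSeries ℝ) = 1 - θ := by
      rw [tsum_eq_sum (s := Finset.range 2)]
      · simp [Finset.sum_range_succ, coeff_one, coeff_X]
      · intro m hm
        have : 2 ≤ m := by rw [Finset.mem_range] at hm; omega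
        rw [map_sub, coeff_C_mul, coeff_one, coeff_X, if_neg (by omega), if_neg (by omega)]
        simp
    rw [h4] at this
    have := (abs_lt.1 hθ).2
    simp at *; linarith
  have ene : ∑' j, coeff j E ≠ 0 := by
    simp only [hE, coeff_mk]
    rw [tsum_geometric_of_norm_lt_one (by simpa using hρ)]
    have := (abs_lt.1 hρ).1
    have : 0 < 1 - -ρ := by linarith
    positivity
  obtain ⟨r1, hr1, hr1'⟩ := geo_r hθ
  obtain ⟨r2, hr2, hr2'⟩ := geo_r hρ
  have UVRL : RL (fun m => coeff m (U * V)) := by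
    rw [cv_coeff]
    exact URL.cv hr1 (geo_summable _ vle hr1 hr1') vne
  have Peq : ∀ m ≥ 2, coeff m P = - (1/2) * coeff m (U * V) := by
    intro m hm
    rw [hP, coeff_C_mul, map_sub, map_add, coeff_C_mul, coeff_one, coeff_X, if_neg (by omega),
      if_neg (by omega)]
    ring
  have PRL : RL (fun m => coeff m P) := by
    refine UVRL.of_equiv (L := -(1/2)) (by norm_num) ?_
    apply tendsto_const_nhds.congr'
    filter_upwards [UVRL.1, eventually_ge_atTop 2] with m a b
    rw [Peq m b, mul_div_assoc, div_self a, mul_one]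
  have uvsum : Summable fun m => |coeff m (U * V)| := by
    have := cv_summable usum vsum
    rwa [← cv_coeff] at this
  have psum : Summable fun m => |coeff m P| := by
    rw [← summable_nat_add_iff 2]
    have := ((summable_nat_add_iff 2).2 uvsum).mul_left (1/2)
    refine this.congr fun m => ?_
    rw [Peq (m+2) (by omega), abs_mul]; norm_num
  constructor
  · rw [hBP, cv_coeff]
    exact PRL.cv hr2 (geo_summable _ ele hr2 hr2') ene
  · rw [hBP]
    have := cv_summable psum esum
    rwa [← cv_coeff] at this


end part2

section part3

open Filter Topology AT
open scoped ENNReal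

/-- possible children of a `c`-node -/
abbrev Ch (n : ℕ) (c : Bool) := {t : AT n // WF t ∧ rootConn t ≠ some c}
/-- trees whose root is a `c`-node -/
abbrev Nd (n : ℕ) (c : Bool) := {t : AT n // WF t ∧ rootConn t = some c}

/-- total size of a list of children -/
def ls {n : ℕ} {c : Bool} (l : List (Ch n c)) : ℕ := sizeList (l.map Subtype.val)

section basics
variable {n : ℕ} {c : Bool}

@[simp] lemma ls_nil : ls ([] : List (Ch n c)) = 0 := by simp [ls, sizeList]
@[simp] lemma ls_cons (a : Ch n c) (l : List (Ch n c)) : ls (a :: l) = size a.1 + ls l := by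
  simp [ls, sizeList]
lemma sizeList_append (a b : List (AT n)) : sizeList (a ++ b) = sizeList a + sizeList b := by
  induction a with
  | nil => simp [sizeList]
  | cons t a ih => simp [sizeList, ih, add_assoc]
@[simp] lemma ls_append (a b : List (Ch n c)) : ls (a ++ b) = ls a + ls b := by
  simp [ls, sizeList_append]
lemma size_pos (t : AT n) : 1 ≤ size t := by
  cases t <;> simp [size]
lemma size_node (l : List (Ch n c)) : size (AT.node c (l.map Subtype.val)) = 1 + ls l := by
  simp [size, ls]
lemma size_le_ls {a : Ch n c} {l : List (Ch n c)} (h : a ∈ l) : size a.1 ≤ ls l := by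
  induction l with
  | nil => simp at h
  | cons b l ih =>
    rcases List.mem_cons.1 h with h | h
    · subst h; simp
    · have := ih h; simp; omega

lemma wf_node (l : List (Ch n c)) (h : 2 ≤ l.length) : WF (AT.node c (l.map Subtype.val)) := by
  refine WF.node c _ (by simpa using h) ?_ ?_
  · intro t ht
    obtain ⟨a, -, rfl⟩ := List.mem_map.1 ht
    exact a.2.1
  · intro t ht
    obtain ⟨a, -, rfl⟩ := List.mem_map.1 ht
    exact a.2.2

/-- build a `c`-node from a list -/
def mkNd (l : List (Ch n c)) (h : 2 ≤ l.length) : Nd n c :=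
  ⟨AT.node c (l.map Subtype.val), wf_node l h, rfl⟩

lemma nd_exists (t : Nd n c) : ∃ (l : List (Ch n c)) (h : 2 ≤ l.length), mkNd l h = t := by
  obtain ⟨t, ht, hc⟩ := t
  cases ht with
  | leaf i b => simp [rootConn] at hc
  | node d ts h1 h2 h3 =>
    simp only [rootConn, Option.some.injEq] at hc
    subst hc
    refine ⟨ts.pmap Subtype.mk (fun t ht => ⟨h2 t ht, h3 t ht⟩), by simpa using h1, ?_⟩
    apply Subtype.ext
    simp [mkNd, List.map_pmap]

lemma map_val_inj {l l' : List (Ch n c)} (h : l.map Subtype.val = l'.map Subtype.val) : l = l' :=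
  List.map_injective_iff.2 Subtype.val_injective h

/-- decomposition of nodes -/
noncomputable def ndEquiv (n : ℕ) (c : Bool) : (Ch n c × Ch n c × List (Ch n c)) ≃ Nd n c :=
  Equiv.ofBijective (fun p => mkNd (p.1 :: p.2.1 :: p.2.2) (by simp)) (by
    constructor
    · rintro ⟨a, b, l⟩ ⟨a', b', l'⟩ h
      simp only [mkNd, Subtype.mk.injEq, AT.node.injEq, true_and] at h
      have := map_val_inj h
      simpa using this
    · intro t
      obtain ⟨l, h, rfl⟩ := nd_exists t
      match l, h with
      | a :: b :: l, h => exact ⟨(a, b, l), rfl⟩)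

/-- leaf as a child -/
def lf (c : Bool) (p : Fin n × Bool) : Ch n c := ⟨AT.leaf p.1 p.2, WF.leaf _ _, by simp [rootConn]⟩
/-- node as a child -/
def ndc (t : Nd n (!c)) : Ch n c := ⟨t.1, t.2.1, by rw [t.2.2]; cases c <;> simp⟩

/-- decomposition of children -/
noncomputable def chEquiv (n : ℕ) (c : Bool) : ((Fin n × Bool) ⊕ Nd n (!c)) ≃ Ch n c :=
  Equiv.ofBijective (Sum.elim (lf c) ndc) (by
    constructor
    · rintro (⟨i, b⟩ | t) (⟨i', b'⟩ | t') h
      · simpa [lf] using h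
      · exfalso
        have h1 : rootConn (lf c (i, b)).1 = rootConn t'.1 :=
          congrArg (fun x : Ch n c => rootConn x.1) h
        rw [t'.2.2] at h1
        simp [lf, rootConn] at h1
      · exfalso
        have h1 : rootConn t.1 = rootConn (lf c (i', b')).1 :=
          congrArg (fun x : Ch n c => rootConn x.1) h
        rw [t.2.2] at h1
        simp [lf, rootConn] at h1
      · simp only [Sum.elim_inr, ndc, Subtype.mk.injEq] at h
        rw [Subtype.ext h]
    · rintro ⟨t, h1, h2⟩
      cases t with
      | leaf i b => exact ⟨Sum.inl (i, b), rfl⟩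
      | node d ts =>
        refine ⟨Sum.inr ⟨_, h1, ?_⟩, rfl⟩
        simp only [rootConn, ne_eq, Option.some.injEq] at h2 ⊢
        revert h2; cases c <;> cases d <;> simp)

lemma tsum_list {α : Type*} (f : List α → ℝ≥0∞) :
    ∑' l, f l = f [] + ∑' a, ∑' l, f (a :: l) := by
  let e : (Unit ⊕ α × List α) ≃ List α :=
    Equiv.ofBijective (Sum.elim (fun _ => []) (fun p => p.1 :: p.2)) (by
      constructor
      · rintro (_ | ⟨a, l⟩) (_ | ⟨a', l'⟩) h <;> simp_all
      · rintro (_ | ⟨a, l⟩)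
        · exact ⟨Sum.inl (), rfl⟩
        · exact ⟨Sum.inr (a, l), rfl⟩)
  rw [← e.tsum_eq, Summable.tsum_sum ENNReal.summable ENNReal.summable]
  · congr 1
    · rw [tsum_fintype]; simp; rfl
    · rw [ENNReal.tsum_prod']; rfl

lemma tsum_ch (f : AT n → ℝ≥0∞) : ∑' t : Ch n c, f t.1 =
    ∑' p : Fin n × Bool, f (AT.leaf p.1 p.2) + ∑' t : Nd n (!c), f t.1 := by
  rw [← (chEquiv n c).tsum_eq, Summable.tsum_sum ENNReal.summable ENNReal.summable]
  rfl

lemma tsum_nd (f : AT n → ℝ≥0∞) : ∑' t : Nd n c, f t.1 =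
    ∑' a : Ch n c, ∑' b : Ch n c, ∑' l : List (Ch n c),
      f (AT.node c (a.1 :: b.1 :: l.map Subtype.val)) := by
  rw [← (ndEquiv n c).tsum_eq, ENNReal.tsum_prod']
  congr 1; funext a
  rw [ENNReal.tsum_prod']
  rfl

end basics

lemma tsum_conv {α β : Type*} (f : α → ℕ) (g : β → ℕ) (m : ℕ) :
    ∑' a, ∑' b, (if f a + g b = m then (1:ℝ≥0∞) else 0) =
    ∑ p ∈ Finset.HasAntidiagonal.antidiagonal m, (∑' a, if f a = p.1 then (1:ℝ≥0∞) else 0) *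
      (∑' b, if g b = p.2 then (1:ℝ≥0∞) else 0) := by
  have h : ∀ a b, (if f a + g b = m then (1:ℝ≥0∞) else 0) =
      ∑ p ∈ Finset.HasAntidiagonal.antidiagonal m,
        (if f a = p.1 then (1:ℝ≥0∞) else 0) * (if g b = p.2 then (1:ℝ≥0∞) else 0) := by
    intro a b
    by_cases h : f a + g b = m
    · rw [if_pos h, Finset.sum_eq_single (f a, g b)]
      · simp
      · rintro ⟨i, j⟩ _ hne
        by_cases h1 : f a = i
        · have : g b ≠ j := by rintro rfl; exact hne (by simp [h1])
          simp [this]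
        · simp [h1]
      · intro h'; exact absurd (Finset.HasAntidiagonal.mem_antidiagonal.2 h) h'
    · rw [if_neg h, Finset.sum_eq_zero]
      rintro ⟨i, j⟩ hij
      rw [Finset.HasAntidiagonal.mem_antidiagonal] at hij
      by_cases h1 : f a = i
      · have : g b ≠ j := by rintro rfl; exact h (by simp_all)
        simp [this]
      · simp [h1]
  simp_rw [h]
  simp_rw [Summable.tsum_finsetSum (fun _ _ => ENNReal.summable), ENNReal.tsum_mul_left,
    ENNReal.tsum_mul_right]

section counts
variable {n : ℕ}

/-- number of `c`-nodes of size `m` -/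
noncomputable def cN (n : ℕ) (c : Bool) (m : ℕ) : ℝ≥0∞ :=
  ∑' t : Nd n c, if size t.1 = m then 1 else 0
/-- number of children of size `m` -/
noncomputable def cC (n : ℕ) (c : Bool) (m : ℕ) : ℝ≥0∞ :=
  ∑' t : Ch n c, if size t.1 = m then 1 else 0
/-- number of lists of size `m` -/
noncomputable def cL (n : ℕ) (c : Bool) (m : ℕ) : ℝ≥0∞ :=
  ∑' l : List (Ch n c), if ls l = m then 1 else 0

lemma cL_eq (c : Bool) (m : ℕ) : cL n c m = (if m = 0 then 1 else 0) +
    ∑ p ∈ Finset.HasAntidiagonal.antidiagonal m, cC n c p.1 * cL n c p.2 := by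
  rw [cL, tsum_list]
  simp only [ls_nil, ls_cons]
  rw [tsum_conv (fun a : Ch n c => size a.1) ls m]
  simp only [eq_comm (a := 0)]
  rfl

lemma cC_eq (c : Bool) (m : ℕ) : cC n c m = (if m = 1 then 2 * (n:ℝ≥0∞) else 0) + cN n (!c) m := by
  rw [cC, tsum_ch (fun t => if size t = m then 1 else 0)]
  congr 1
  simp only [size, eq_comm (a := 1)]
  rw [tsum_fintype]
  split_ifs <;> simp [mul_comm]

lemma cC_zero (c : Bool) : cC n c 0 = 0 := by
  rw [cC, ENNReal.tsum_eq_zero]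
  intro t
  have := size_pos t.1
  rw [if_neg (by omega)]

lemma cN_zero (c : Bool) : cN n c 0 = 0 := by
  rw [cN, ENNReal.tsum_eq_zero]
  intro t
  have := size_pos t.1
  rw [if_neg (by omega)]

lemma cN_succ (c : Bool) (m : ℕ) : cN n c (m+1) =
    ∑ p ∈ Finset.HasAntidiagonal.antidiagonal m, cC n c p.1 *
      ∑ q ∈ Finset.HasAntidiagonal.antidiagonal p.2, cC n c q.1 * cL n c q.2 := by
  rw [cN, tsum_nd (fun t => if size t = m + 1 then 1 else 0)]
  have : ∀ (a b : Ch n c) (l : List (Ch n c)),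
      (size (AT.node c (a.1 :: b.1 :: l.map Subtype.val)) = m + 1) ↔
      size a.1 + (size b.1 + ls l) = m := by
    intro a b l
    simp only [size, sizeList, ls]; omega
  simp only [this]
  have h := fun a : Ch n c => ENNReal.tsum_prod' (f := fun p : Ch n c × List (Ch n c) =>
      if size a.1 + (size p.1.1 + ls p.2) = m then (1:ℝ≥0∞) else 0)
  simp only at h
  simp_rw [← h]
  rw [tsum_conv (fun a : Ch n c => size a.1)
    (fun p : Ch n c × List (Ch n c) => size p.1.1 + ls p.2) m]
  apply Finset.sum_congr rfl
  intro p _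
  congr 1
  rw [ENNReal.tsum_prod', tsum_conv (fun a : Ch n c => size a.1) ls]
  rfl

lemma cN_fin_eq (m : ℕ) : (∀ c, cC n c m ≠ ⊤) ∧ (∀ c, cL n c m ≠ ⊤) ∧ (∀ c, cN n c m ≠ ⊤) ∧
    (∀ c, cC n c m = cC n true m) ∧ (∀ c, cL n c m = cL n true m) ∧
    (∀ c, cN n c m = cN n true m) := by
  induction m using Nat.strong_induction_on with
  | _ m ih =>
  have hN : (∀ c, cN n c m ≠ ⊤) ∧ (∀ c, cN n c m = cN n true m) := by
    cases m with
    | zero => simp [cN_zero]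
    | succ m =>
      simp only [cN_succ]
      constructor
      · intro c
        refine ENNReal.sum_ne_top.2 fun p hp => ENNReal.mul_ne_top ?_ ?_
        · rw [Finset.HasAntidiagonal.mem_antidiagonal] at hp
          exact (ih p.1 (by omega)).1 c
        · refine ENNReal.sum_ne_top.2 fun q hq => ENNReal.mul_ne_top ?_ ?_
          all_goals rw [Finset.HasAntidiagonal.mem_antidiagonal] at hp hq
          · exact (ih q.1 (by omega)).1 c
          · exact (ih q.2 (by omega)).2.1 c
      · intro c
        refine Finset.sum_congr rfl fun p hp => ?_
        rw [Finset.HasAntidiagonal.mem_antidiagonal] at hp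
        rw [(ih p.1 (by omega)).2.2.2.1 c]
        congr 1
        refine Finset.sum_congr rfl fun q hq => ?_
        rw [Finset.HasAntidiagonal.mem_antidiagonal] at hq
        rw [(ih q.1 (by omega)).2.2.2.1 c, (ih q.2 (by omega)).2.2.2.2.1 c]
  have hC : (∀ c, cC n c m ≠ ⊤) ∧ (∀ c, cC n c m = cC n true m) := by
    simp only [cC_eq]
    constructor
    · intro c
      refine ENNReal.add_ne_top.2 ⟨?_, hN.1 _⟩
      split_ifs
      · exact ENNReal.mul_ne_top (by simp) (by simp)
      · simp
    · intro c
      rw [hN.2 (!c), hN.2 (!true)]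
  have hL : (∀ c, cL n c m ≠ ⊤) ∧ (∀ c, cL n c m = cL n true m) := by
    constructor
    · intro c
      rw [cL_eq]
      refine ENNReal.add_ne_top.2 ⟨by split_ifs <;> simp, ?_⟩
      refine ENNReal.sum_ne_top.2 fun p hp => ?_
      rw [Finset.HasAntidiagonal.mem_antidiagonal] at hp
      by_cases h : p.1 = 0
      · simp [h, cC_zero]
      · refine ENNReal.mul_ne_top ?_ ((ih p.2 (by omega)).2.1 c)
        by_cases h' : p.1 = m
        · rw [h']; exact hC.1 c
        · exact (ih p.1 (by omega)).1 c
    · intro c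
      rw [cL_eq, cL_eq]
      congr 1
      refine Finset.sum_congr rfl fun p hp => ?_
      rw [Finset.HasAntidiagonal.mem_antidiagonal] at hp
      by_cases h : p.1 = 0
      · simp [h, cC_zero]
      · rw [(ih p.2 (by omega)).2.2.2.2.1 c]
        congr 1
        by_cases h' : p.1 = m
        · rw [h']; exact hC.2 c
        · exact (ih p.1 (by omega)).2.2.2.1 c
  exact ⟨hC.1, hL.1, hN.1, hC.2, hL.2, hN.2⟩

lemma cC_ne_top (c m) : cC n c m ≠ ⊤ := (cN_fin_eq m).1 c
lemma cL_ne_top (c m) : cL n c m ≠ ⊤ := (cN_fin_eq m).2.1 c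
lemma cN_ne_top (c m) : cN n c m ≠ ⊤ := (cN_fin_eq m).2.2.1 c
lemma cC_true (c m) : cC n c m = cC n true m := (cN_fin_eq m).2.2.2.1 c
lemma cL_true (c m) : cL n c m = cL n true m := (cN_fin_eq m).2.2.2.2.1 c
lemma cN_true (c m) : cN n c m = cN n true m := (cN_fin_eq m).2.2.2.2.2 c

open PowerSeries in
lemma gf_eq (n : ℕ) : ∃ B : PowerSeries ℝ, (∀ m, coeff m B = (cC n true m).toReal) ∧
    constantCoeff B = 0 ∧
    B * (1 - B) = C (2 * (n:ℝ)) * X * (1 - B) + X * B ^ 2 := by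
  set B : PowerSeries ℝ := mk fun m => (cC n true m).toReal with hB
  set L : PowerSeries ℝ := mk fun m => (cL n true m).toReal with hL
  have conv : ∀ m, coeff m (B * L) = (∑ q ∈ Finset.HasAntidiagonal.antidiagonal m,
      cC n true q.1 * cL n true q.2).toReal := by
    intro m
    rw [coeff_mul, ENNReal.toReal_sum]
    · simp [hB, hL]
    · intro q _; exact ENNReal.mul_ne_top (cC_ne_top _ _) (cL_ne_top _ _)
  have convfin : ∀ m, (∑ q ∈ Finset.HasAntidiagonal.antidiagonal m,
      cC n true q.1 * cL n true q.2) ≠ ⊤ := by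
    intro m
    refine ENNReal.sum_ne_top.2 fun q _ => ENNReal.mul_ne_top (cC_ne_top _ _) (cL_ne_top _ _)
  have e1 : L = 1 + B * L := by
    ext m
    rw [map_add, conv, coeff_one, hL, coeff_mk, cL_eq, ENNReal.toReal_add (by split_ifs <;> simp)
      (convfin m)]
    congr 1
    split_ifs <;> simp
  have e2 : B = C (2 * (n:ℝ)) * X + X * (B * (B * L)) := by
    ext m
    rw [map_add, hB, coeff_mk, cC_eq, ENNReal.toReal_add
      (by split_ifs <;> simp [ENNReal.mul_ne_top]) (cN_ne_top _ _)]
    congr 1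
    · rw [coeff_C_mul, coeff_X]; split_ifs <;> simp
    · rw [cN_true, ← hB]
      cases m with
      | zero => simp [cN_zero]
      | succ m =>
        rw [coeff_succ_X_mul, cN_succ, coeff_mul, ENNReal.toReal_sum]
        · refine Finset.sum_congr rfl fun p _ => ?_
          rw [conv, ENNReal.toReal_mul, hB, coeff_mk]
        · intro p _
          exact ENNReal.mul_ne_top (cC_ne_top _ _) (convfin _)
  refine ⟨B, fun m => by rw [hB, coeff_mk], ?_, ?_⟩
  · rw [← coeff_zero_eq_constantCoeff_apply, hB, coeff_mk, cC_zero]; simp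
  · linear_combination (1 - B) * e2 + X * B ^ 2 * e1

end counts


end part3

section part4

open Filter Topology AT
open scoped ENNReal

/-- square root of the number of literals -/
noncomputable def srt (n : ℕ) : ℝ := √(2 * (n:ℝ))
/-- the singularity -/
noncomputable def rho (n : ℕ) : ℝ := 1 / (srt n * (srt n + 2))
/-- the singularity, as extended nonnegative real -/
noncomputable def rE (n : ℕ) : ℝ≥0∞ := ENNReal.ofReal (rho n)

section weights
variable {n : ℕ}

lemma srt_srt (n : ℕ) : srt n * srt n = 2 * n := Real.mul_self_sqrt (by positivity)
lemma srt_ge (hn : 1 ≤ n) : 1 ≤ srt n := by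
  rw [srt, Real.one_le_sqrt]
  have : (1:ℝ) ≤ n := by exact_mod_cast hn
  linarith
lemma rho_pos (hn : 1 ≤ n) : 0 < rho n := by
  have := srt_ge hn
  unfold rho; positivity
lemma rho_lt (hn : 1 ≤ n) : rho n < 1 := by
  have := srt_ge hn
  unfold rho
  rw [div_lt_one (by positivity)]
  nlinarith
lemma rE_ne_top (n : ℕ) : rE n ≠ ⊤ := ENNReal.ofReal_ne_top
lemma rE_ne_zero (hn : 1 ≤ n) : rE n ≠ 0 := by
  simpa [rE] using rho_pos hn

open PowerSeries in
lemma cC_RL (hn : 1 ≤ n) : RL (fun m => (cC n true m).toReal * rho n ^ m) ∧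
    Summable (fun m => (cC n true m).toReal * rho n ^ m) := by
  obtain ⟨B, hB, h0, h⟩ := gf_eq n
  have hs := srt_ge hn
  have h2 := srt_srt n
  have key := main_an (rescale (rho n) B) (2 * n * rho n) (rho n) ((srt n - 2) / (srt n + 2))
    (by rw [← coeff_zero_eq_constantCoeff_apply, coeff_rescale]; simp [h0])
    (by
      have := congrArg (rescale (rho n)) h
      simp only [map_mul, map_sub, map_one, map_add, map_pow, rescale_X] at this
      have hc : rescale (rho n) (C (2 * (n:ℝ))) = C (2 * (n:ℝ)) := by
        ext m
        rw [coeff_rescale, coeff_C]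
        split_ifs with hm <;> simp [hm]
      have hc2 : (C (2 * (n:ℝ) * rho n) : PowerSeries ℝ) = C (2 * (n:ℝ)) * C (rho n) := by
        rw [← map_mul]
      simp only [← map_mul] at this
      rw [hc] at this
      rw [this, hc2]; ring)
    (by rw [← h2, rho]; field_simp; ring)
    (by rw [← h2, rho]; field_simp; ring)
    (by rw [abs_lt]; constructor
        · rw [lt_div_iff₀ (by positivity)]; linarith
        · rw [div_lt_iff₀ (by positivity)]; linarith)
    (by rw [abs_of_pos (rho_pos hn)]; exact rho_lt hn)
  simp only [coeff_rescale, hB] at key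
  have e : ∀ m, rho n ^ m * (cC n true m).toReal = (cC n true m).toReal * rho n ^ m :=
    fun m => mul_comm _ _
  simp only [e] at key
  refine ⟨key.1, key.2.congr fun m => ?_⟩
  rw [abs_of_nonneg]
  have := rho_pos hn
  positivity

/-- number of nodes of size `m` with a given root connective -/
noncomputable def nu (n m : ℕ) : ℝ≥0∞ := cN n true m

lemma nu_ne_top (m : ℕ) : nu n m ≠ ⊤ := cN_ne_top _ _

lemma nu_eq {m : ℕ} (hm : 2 ≤ m) : cC n true m = nu n m := by
  rw [cC_eq, if_neg (by omega), zero_add, cN_true]; rfl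

lemma nu_ev (hn : 1 ≤ n) : ∀ᶠ m in atTop, nu n m ≠ 0 := by
  filter_upwards [(cC_RL hn).1.1, eventually_ge_atTop 2] with m h1 h2 h
  rw [nu_eq h2, h] at h1
  simp at h1

lemma nu_ratio (hn : 1 ≤ n) (k : ℕ) :
    Tendsto (fun m => nu n (m - k) / nu n m) atTop (𝓝 (rE n ^ k)) := by
  have h := (cC_RL hn).1.shift k
  have hr := rho_pos hn
  have h2 : Tendsto (fun m => (nu n (m-k)).toReal / (nu n m).toReal) atTop (𝓝 (rho n ^ k)) := by
    have h3 := h.mul_const (rho n ^ k)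
    rw [one_mul] at h3
    refine h3.congr' ?_
    filter_upwards [eventually_ge_atTop (k+2), nu_ev hn] with m hm h0
    rw [nu_eq (by omega), nu_eq (by omega)]
    have : (nu n m).toReal ≠ 0 := by
      simp [ENNReal.toReal_eq_zero_iff, h0, nu_ne_top]
    have e : rho n ^ m = rho n ^ (m-k) * rho n ^ k := by rw [← pow_add]; congr 1; omega
    rw [e]
    field_simp
  have h4 := ENNReal.tendsto_ofReal h2
  rw [ENNReal.ofReal_pow hr.le] at h4
  refine h4.congr' ?_
  filter_upwards [nu_ev hn] with m h0
  rw [ENNReal.ofReal_div_of_pos (ENNReal.toReal_pos h0 (nu_ne_top _)),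
    ENNReal.ofReal_toReal (nu_ne_top _), ENNReal.ofReal_toReal (nu_ne_top _)]

/-- weight of children -/
noncomputable def wC (n : ℕ) (c : Bool) : ℝ≥0∞ := ∑' t : Ch n c, rE n ^ size t.1
/-- weight of lists -/
noncomputable def wL (n : ℕ) (c : Bool) : ℝ≥0∞ := ∑' l : List (Ch n c), rE n ^ ls l
/-- weight of nodes -/
noncomputable def wN (n : ℕ) (c : Bool) : ℝ≥0∞ := ∑' t : Nd n c, rE n ^ size t.1

lemma wC_eq_sum (c : Bool) : wC n c = ∑' m, cC n true m * rE n ^ m := by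
  have : ∀ t : Ch n c, rE n ^ size t.1 =
      ∑' m, (if size t.1 = m then 1 else 0) * rE n ^ m := by
    intro t
    rw [tsum_eq_single (size t.1)]
    · simp
    · intro m hm; rw [if_neg (Ne.symm hm)]; simp
  rw [wC]
  simp_rw [this]
  rw [ENNReal.tsum_comm]
  congr 1; funext m
  rw [ENNReal.tsum_mul_right, ← cC_true c]; rfl

lemma wC_ne_top (hn : 1 ≤ n) (c : Bool) : wC n c ≠ ⊤ := by
  rw [wC_eq_sum]
  have h := (cC_RL hn).2
  have hr := rho_pos hn
  have := h.tsum_ofReal_ne_top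
  convert this using 3 with m
  rw [ENNReal.ofReal_mul (by positivity), ENNReal.ofReal_toReal (cC_ne_top _ _),
    ENNReal.ofReal_pow hr.le]; rfl

lemma wC_indep (c d : Bool) : wC n c = wC n d := by rw [wC_eq_sum, wC_eq_sum]

lemma wL_len (c : Bool) (k : ℕ) :
    ∑' l : List (Ch n c), (if l.length = k then rE n ^ ls l else 0) = wC n c ^ k := by
  induction k with
  | zero =>
    rw [tsum_list]; simp
  | succ k ih =>
    rw [tsum_list]
    simp only [List.length_nil,
      List.length_cons, ls_cons, add_left_inj]
    rw [if_neg (by omega), zero_add]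
    rw [pow_succ', ← ih, wC, ← ENNReal.tsum_mul_right]
    congr 1; funext a
    rw [← ENNReal.tsum_mul_left]
    congr 1; funext l
    split_ifs
    · rw [pow_add]
    · simp

lemma wL_geom (c : Bool) : wL n c = (1 - wC n c)⁻¹ := by
  rw [← ENNReal.tsum_geometric]
  simp_rw [← wL_len]
  rw [ENNReal.tsum_comm, wL]
  congr 1; funext l
  rw [tsum_eq_single l.length]
  · simp
  · intro m hm; rw [if_neg (Ne.symm hm)]

lemma wN_eq (c : Bool) : wN n c = rE n * (wC n c * (wC n c * wL n c)) := by
  rw [wN, tsum_nd (fun t => rE n ^ size t)]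
  have : ∀ (a b : Ch n c) (l : List (Ch n c)),
      rE n ^ (size (AT.node c (a.1 :: b.1 :: l.map Subtype.val))) =
      rE n * (rE n ^ size a.1 * (rE n ^ size b.1 * rE n ^ ls l)) := by
    intro a b l
    simp only [size, sizeList, ls, pow_add, pow_one]
  simp_rw [this, ENNReal.tsum_mul_left, ENNReal.tsum_mul_right]
  rfl

lemma wC_eq (c : Bool) : wC n c = 2 * n * rE n + wN n (!c) := by
  rw [wC, tsum_ch (fun t => rE n ^ size t)]
  congr 1
  rw [tsum_fintype]
  simp [size]; ring

lemma wC_val (hn : 1 ≤ n) (c : Bool) : wC n c = ENNReal.ofReal (srt n / (srt n + 1)) := by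
  have hs := srt_ge hn
  have ht := wC_ne_top hn c
  have e := wC_eq (n := n) c
  rw [wN_eq, wL_geom, wC_indep (!c) c] at e
  have hpos : 0 < wC n c := by
    rw [e]
    have : (n:ℝ≥0∞) ≠ 0 := by simp; omega
    simp [pos_iff_ne_zero, this, rE_ne_zero hn]
  have hlt : wC n c < 1 := by
    by_contra hge
    push Not at hge
    rw [tsub_eq_zero_of_le hge, ENNReal.inv_zero, ENNReal.mul_top hpos.ne',
      ENNReal.mul_top hpos.ne', ENNReal.mul_top (rE_ne_zero hn), add_top] at e
    exact ht e
  rw [← ENNReal.ofReal_toReal ht]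
  congr 1
  have e2 := congrArg ENNReal.toReal e
  have hsub : 1 - wC n c ≠ 0 := (tsub_pos_of_lt hlt).ne'
  rw [ENNReal.toReal_add (by simp [ENNReal.mul_ne_top, rE_ne_top])
    (by simp [ENNReal.mul_eq_top, rE_ne_top, ht, hsub])] at e2
  simp only [ENNReal.toReal_mul, ENNReal.toReal_inv, ENNReal.toReal_ofNat, ENNReal.toReal_natCast,
    ENNReal.toReal_sub_of_le hlt.le ENNReal.one_ne_top, ENNReal.toReal_one] at e2
  have hr : (rE n).toReal = rho n := ENNReal.toReal_ofReal (rho_pos hn).le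
  rw [hr, ← srt_srt] at e2
  have hW : (wC n c).toReal < 1 := by
    have := (ENNReal.toReal_lt_toReal ht ENNReal.one_ne_top).2 hlt
    simpa using this
  set W := (wC n c).toReal
  have hW' : 1 - W ≠ 0 := by linarith
  rw [rho] at e2
  field_simp at e2
  have e3 : ((srt n + 1) * W - srt n)^2 = 0 := by
    linear_combination -e2
  have e4 := pow_eq_zero_iff (two_ne_zero) |>.1 e3
  field_simp
  linarith

lemma wL_val (hn : 1 ≤ n) (c : Bool) : wL n c = ENNReal.ofReal (srt n + 1) := by
  have hs := srt_ge hn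
  rw [wL_geom, wC_val hn, ← ENNReal.ofReal_one, ← ENNReal.ofReal_sub _ (by positivity),
    ← ENNReal.ofReal_inv_of_pos]
  · congr 1; field_simp; ring
  · rw [sub_pos, div_lt_one (by positivity)]; linarith

lemma wN_val (hn : 1 ≤ n) (c : Bool) :
    wN n c = ENNReal.ofReal (srt n / ((srt n + 1) * (srt n + 2))) := by
  have hs := srt_ge hn
  have hr := rho_pos hn
  rw [wN_eq, wL_val hn, wC_val hn, rE, ← ENNReal.ofReal_mul (by positivity),
    ← ENNReal.ofReal_mul (by positivity), ← ENNReal.ofReal_mul (by positivity)]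
  congr 1; rw [rho]; field_simp

end weights


end part4

section part5

open Filter Topology AT
open scoped ENNReal

/-- one-level contexts around a marked child of a `c`-node -/
abbrev Ctx (n : ℕ) (c : Bool) := List (Ch n c) × List (Ch n c)

section ctx
variable {n : ℕ} {c : Bool}

/-- total size of siblings -/
def csz (C : Ctx n c) : ℕ := ls C.1 + ls C.2

/-- the context is nonempty -/
abbrev cne (C : Ctx n c) : Prop := C.1.length + C.2.length ≠ 0

/-- limit weight of a context -/
noncomputable def mu (C : Ctx n c) : ℝ≥0∞ := if cne C then rE n ^ (1 + csz C) else 0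

/-- plug a tree in a context -/
def plug (C : Ctx n c) (t : AT n) : AT n :=
  .node c (C.1.map Subtype.val ++ t :: C.2.map Subtype.val)

lemma plug_eq (C : Ctx n c) (t : Nd n (!c)) :
    plug C t.1 = AT.node c ((C.1 ++ ndc t :: C.2).map Subtype.val) := by
  simp [plug, ndc]

/-- plugging as a node -/
def plugNd (C : Ctx n c) (t : Nd n (!c)) (h : cne C) : Nd n c :=
  ⟨plug C t.1, by rw [plug_eq]; exact wf_node _ (by simp; omega), rfl⟩

lemma size_plug (C : Ctx n c) (t : Nd n (!c)) : size (plug C t.1) = 1 + csz C + size t.1 := by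
  rw [plug_eq, size_node]
  simp [csz, ndc]; omega

lemma plug_inj {C C' : Ctx n c} {t t' : Nd n (!c)} (h : plug C t.1 = plug C' t'.1)
    (h1 : csz C < size t.1) (h2 : csz C' < size t'.1) : C = C' ∧ t = t' := by
  rw [plug_eq, plug_eq] at h
  simp only [AT.node.injEq, true_and] at h
  have h := map_val_inj h
  obtain ⟨l, r⟩ := C
  obtain ⟨l', r'⟩ := C'
  simp only [csz] at *
  have key : ∀ {l r l' r' : List (Ch n c)} {t t' : Nd n (!c)} {a : List (Ch n c)},
      ls l + ls r < size t.1 → ls l' + ls r' < size t'.1 → l' = l ++ a →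
      ndc t :: r = a ++ ndc t' :: r' → (l, r) = (l', r') ∧ t = t' := by
    intro l r l' r' t t' a h1 h2 e1 e2
    cases a with
    | nil =>
      simp only [List.nil_append, List.cons.injEq, List.append_nil] at e1 e2
      refine ⟨by rw [e1, e2.2], ?_⟩
      have := congrArg Subtype.val e2.1
      exact Subtype.ext this
    | cons b a =>
      simp only [List.cons_append, List.cons.injEq] at e2
      have m1 : ndc t ∈ l' := by rw [e1, ← e2.1]; simp
      have m2 : ndc t' ∈ r := by rw [e2.2]; simp
      have s1 : size t.1 ≤ ls l' := size_le_ls m1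
      have s2 : size t'.1 ≤ ls r := size_le_ls m2
      omega
  rcases List.append_eq_append_iff.1 h with ⟨a, e1, e2⟩ | ⟨a, e1, e2⟩
  · exact key h1 h2 e1 e2
  · have := key h2 h1 e1 e2
    exact ⟨this.1.symm, this.2.symm⟩

open Classical in
/-- number of `c`-nodes of size `m` in a family -/
noncomputable def Q (n : ℕ) (c : Bool) (T : Set (AT n)) (m : ℕ) : ℝ≥0∞ :=
  ∑' t : Nd n c, if size t.1 = m ∧ t.1 ∈ T then 1 else 0

/-- the trace of a family on a context -/
def tr (T : Set (AT n)) (C : Ctx n c) : Set (AT n) := {t | plug C t ∈ T}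

lemma Q_compl (T : Set (AT n)) (m : ℕ) : Q n c T m + Q n c Tᶜ m = nu n m := by
  classical
  rw [Q, Q, ← ENNReal.tsum_add, nu, ← cN_true c, cN]
  congr 1; funext t
  by_cases h : t.1 ∈ T <;> simp [h]

lemma Q_le (T : Set (AT n)) (m : ℕ) : Q n c T m ≤ nu n m := by
  rw [← Q_compl (c := c) T m]; exact le_self_add

lemma Q_ctx (T : Set (AT n)) (m : ℕ) :
    ∑' C : Ctx n c, (if cne C ∧ 2 * csz C + 1 < m then Q n (!c) (tr T C) (m - (1 + csz C)) else 0)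
      ≤ Q n c T m := by
  classical
  let P : Set (Ctx n c × Nd n (!c)) := {p | (cne p.1 ∧ 2 * csz p.1 + 1 < m) ∧
    size p.2.1 = m - (1 + csz p.1)}
  have e : ∀ C : Ctx n c,
      (if cne C ∧ 2 * csz C + 1 < m then Q n (!c) (tr T C) (m - (1 + csz C)) else 0) =
      ∑' t : Nd n (!c), P.indicator (fun p => if plug p.1 p.2.1 ∈ T then (1:ℝ≥0∞) else 0) (C, t) := by
    intro C
    split_ifs with h
    · rw [Q]
      congr 1; funext t
      by_cases h2 : size t.1 = m - (1 + csz C)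
      · rw [Set.indicator_of_mem (by exact ⟨h, h2⟩)]
        simp [h2, tr]
      · rw [Set.indicator_of_notMem (by rintro ⟨_, h3⟩; exact h2 h3)]
        simp [h2]
    · symm
      rw [ENNReal.tsum_eq_zero]
      intro t
      rw [Set.indicator_of_notMem (by rintro ⟨h3, _⟩; exact h h3)]
  simp_rw [e]
  rw [← ENNReal.tsum_prod (f := fun C t =>
    P.indicator (fun p => if plug p.1 p.2.1 ∈ T then (1:ℝ≥0∞) else 0) (C, t)),
    ← tsum_subtype P (fun p => if plug p.1 p.2.1 ∈ T then (1:ℝ≥0∞) else 0)]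
  let f : P → Nd n c := fun p => plugNd p.1.1 p.1.2 p.2.1.1
  have hf : Function.Injective f := by
    rintro ⟨⟨C, t⟩, ⟨⟨h1, h2⟩, h3⟩⟩ ⟨⟨C', t'⟩, ⟨⟨h1', h2'⟩, h3'⟩⟩ h
    have h := congrArg Subtype.val h
    simp only at h1 h2 h3 h1' h2' h3'
    have := plug_inj (C := C) (C' := C') (t := t) (t' := t') h (by omega) (by omega)
    simp [this.1, this.2]
  refine le_trans (le_of_eq ?_) (ENNReal.tsum_comp_le_tsum_of_injective hf _)
  congr 1; funext ⟨⟨C, t⟩, ⟨⟨h1, h2⟩, h3⟩⟩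
  simp only at h1 h2 h3
  have hs : size (plug C t.1) = m := by rw [size_plug]; omega
  simp [f, plugNd, hs]

/-- proportion -/
noncomputable def q (n : ℕ) (c : Bool) (T : Set (AT n)) (m : ℕ) : ℝ≥0∞ := Q n c T m / nu n m
/-- lower limiting proportion -/
noncomputable def Lo (n : ℕ) (c : Bool) (T : Set (AT n)) : ℝ≥0∞ := liminf (q n c T) atTop
/-- upper limiting proportion -/
noncomputable def Up (n : ℕ) (c : Bool) (T : Set (AT n)) : ℝ≥0∞ := limsup (q n c T) atTop

lemma q_compl (hn : 1 ≤ n) (T : Set (AT n)) : ∀ᶠ m in atTop, q n c T m + q n c Tᶜ m = 1 := by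
  filter_upwards [nu_ev hn] with m h
  rw [q, q, ← ENNReal.add_div, Q_compl, ENNReal.div_self h (nu_ne_top _)]

lemma Lo_le_Up (T : Set (AT n)) : Lo n c T ≤ Up n c T := liminf_le_limsup

lemma q_le_one (T : Set (AT n)) (m : ℕ) : q n c T m ≤ 1 := by
  rw [q]
  exact ENNReal.div_le_of_le_mul (by rw [one_mul]; exact Q_le T m)

lemma Up_le_one (T : Set (AT n)) : Up n c T ≤ 1 := by
  exact limsup_le_of_le (h := Eventually.of_forall (q_le_one T))

lemma Up_eq (hn : 1 ≤ n) (T : Set (AT n)) : Up n c T = 1 - Lo n c Tᶜ := by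
  rw [Up, Lo, ← ENNReal.limsup_const_sub _ _ ENNReal.one_ne_top]
  apply limsup_congr
  filter_upwards [q_compl (c := c) hn T] with m h
  rw [← h, ENNReal.add_sub_cancel_right]
  exact ne_top_of_le_ne_top ENNReal.one_ne_top (q_le_one _ _)

lemma Up_add (hn : 1 ≤ n) (T : Set (AT n)) : Up n c T + Lo n c Tᶜ = 1 := by
  rw [Up_eq hn, tsub_add_cancel_of_le]
  exact (Lo_le_Up _).trans (Up_le_one _)

lemma fatou {ι : Type*} (f : ℕ → ι → ℝ≥0∞) :
    ∑' i, liminf (fun m => f m i) atTop ≤ liminf (fun m => ∑' i, f m i) atTop := by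
  let _ : MeasurableSpace ι := ⊤
  have := MeasureTheory.lintegral_liminf_le (μ := MeasureTheory.Measure.count) (f := f)
    (u := atTop) (fun i => measurable_from_top)
  simpa only [MeasureTheory.lintegral_count] using this

lemma Lo_ctx (hn : 1 ≤ n) (T : Set (AT n)) :
    ∑' C : Ctx n c, mu C * Lo n (!c) (tr T C) ≤ Lo n c T := by
  have h1 : Lo n c T ≥ liminf (fun m => ∑' C : Ctx n c, (if cne C ∧ 2 * csz C + 1 < m then
      Q n (!c) (tr T C) (m - (1 + csz C)) else 0) / nu n m) atTop := by
    refine liminf_le_liminf (Eventually.of_forall fun m => ?_)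
    simp only [div_eq_mul_inv]
    rw [ENNReal.tsum_mul_right, q, div_eq_mul_inv]
    gcongr
    exact Q_ctx T m
  refine le_trans ?_ h1
  refine le_trans ?_ (fatou _)
  refine ENNReal.tsum_le_tsum fun C => ?_
  rw [mu]
  split_ifs with hC
  swap
  · simp
  have h2 : liminf (fun m => nu n (m - (1 + csz C)) / nu n m) atTop = rE n ^ (1 + csz C) :=
    (nu_ratio hn _).liminf_eq
  have h3 : liminf (fun m => q n (!c) (tr T C) (m - (1 + csz C))) atTop = Lo n (!c) (tr T C) := by
    rw [Lo, ← liminf_nat_add _ (1 + csz C)]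
    simp only [add_tsub_cancel_right]
  rw [← h2, ← h3]
  refine ENNReal.le_liminf_mul.trans ?_
  refine liminf_le_liminf ?_
  have h5 : ∀ᶠ m in atTop, nu n (m - (1 + csz C)) ≠ 0 := by
    have := nu_ev hn
    rw [← map_sub_atTop_eq_nat (1 + csz C)] at this
    exact this
  filter_upwards [nu_ev hn, h5, eventually_gt_atTop (2 * csz C + 1)] with m h0 h0' hm
  rw [if_pos ⟨hC, hm⟩, Pi.mul_apply, q]
  apply le_of_eq
  simp only [div_eq_mul_inv]
  rw [mul_comm]
  have hc := ENNReal.mul_inv_cancel h0' (nu_ne_top (n := n) _)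
  calc _ = Q n (!c) (tr T C) (m - (1 + csz C)) *
      (nu n (m - (1 + csz C)) * (nu n (m - (1 + csz C)))⁻¹) * (nu n m)⁻¹ := by ring
    _ = _ := by rw [hc, mul_one]

lemma tsum_ctx : ∑' C : Ctx n c, rE n ^ (1 + csz C) = rE n * (wL n c * wL n c) := by
  rw [ENNReal.tsum_prod']
  simp only [csz, pow_add, pow_one, ENNReal.tsum_mul_left, ENNReal.tsum_mul_right]
  rfl

lemma tsum_mu (hn : 1 ≤ n) : ∑' C : Ctx n c, mu C = 1 := by
  classical
  have hs := srt_ge hn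
  have hr := rho_pos hn
  have h : ∑' C : Ctx n c, mu C + rE n = ∑' C : Ctx n c, rE n ^ (1 + csz C) := by
    have e : rE n = ∑' C : Ctx n c, if C = ([], []) then rE n else 0 := by
      rw [tsum_ite_eq]
    rw [e, ← ENNReal.tsum_add, ← e]
    congr 1; funext ⟨l, r⟩
    by_cases hC : cne (l, r)
    · have : (l, r) ≠ ([], []) := by rintro h; simp at h; simp [cne, h] at hC
      rw [mu, if_pos hC, if_neg this, add_zero]
    · rw [mu, if_neg hC]
      simp [cne] at hC
      simp [hC, csz]
  rw [tsum_ctx, wL_val hn] at h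
  have h2 : rE n * (ENNReal.ofReal (srt n + 1) * ENNReal.ofReal (srt n + 1)) = 1 + rE n := by
    rw [rE, ← ENNReal.ofReal_mul (by positivity), ← ENNReal.ofReal_mul (by positivity),
      ← ENNReal.ofReal_one, ← ENNReal.ofReal_add (by positivity) (by positivity)]
    congr 1; rw [rho]; field_simp; ring
  rw [h2] at h
  exact (ENNReal.add_left_inj (rE_ne_top n)).1 h

lemma tr_compl (T : Set (AT n)) (C : Ctx n c) : tr Tᶜ C = (tr T C)ᶜ := rfl

lemma Up_ctx (hn : 1 ≤ n) (T : Set (AT n)) :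
    Up n c T ≤ ∑' C : Ctx n c, mu C * Up n (!c) (tr T C) := by
  rw [Up_eq hn, tsub_le_iff_right]
  refine le_trans ?_ (add_le_add_right (Lo_ctx hn Tᶜ) _)
  rw [← ENNReal.tsum_add]
  simp_rw [tr_compl, ← mul_add, Up_add hn, mul_one, tsum_mu hn]
  exact le_rfl

/-- oscillation -/
noncomputable def osc (n : ℕ) (c : Bool) (T : Set (AT n)) : ℝ≥0∞ := Up n c T - Lo n c T

lemma osc_ctx (hn : 1 ≤ n) (T : Set (AT n)) :
    osc n c T ≤ ∑' C : Ctx n c, mu C * osc n (!c) (tr T C) := by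
  rw [osc, tsub_le_iff_right]
  refine le_trans (Up_ctx hn T) (le_trans ?_ (add_le_add_right (Lo_ctx hn T) _))
  rw [← ENNReal.tsum_add]
  refine ENNReal.tsum_le_tsum fun C => ?_
  rw [← mul_add, osc, tsub_add_cancel_of_le (Lo_le_Up _)]

lemma osc_le_one (T : Set (AT n)) : osc n c T ≤ 1 := tsub_le_self.trans (Up_le_one _)

lemma q_congr {T T' : Set (AT n)} (h : ∀ t : Nd n c, t.1 ∈ T ↔ t.1 ∈ T') : q n c T = q n c T' := by
  funext m
  rw [q, q, Q, Q]
  congr 2; funext t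
  congr 1
  exact propext (and_congr_right fun _ => h t)

lemma q_mono {T T' : Set (AT n)} (h : ∀ t : Nd n c, t.1 ∈ T → t.1 ∈ T') (m : ℕ) :
    q n c T m ≤ q n c T' m := by
  classical
  rw [q, q, Q, Q]
  gcongr with t
  by_cases h1 : size t.1 = m ∧ t.1 ∈ T
  · rw [if_pos h1, if_pos ⟨h1.1, h t h1.2⟩]
  · rw [if_neg h1]; exact zero_le

lemma Up_mono {T T' : Set (AT n)} (h : ∀ t : Nd n c, t.1 ∈ T → t.1 ∈ T') :
    Up n c T ≤ Up n c T' := 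
  limsup_le_limsup (Eventually.of_forall (q_mono h))

lemma q_empty (m : ℕ) : q n c ∅ m = 0 := by simp [q, Q]

lemma Up_empty : Up n c ∅ = 0 := by
  rw [Up]; simp only [funext q_empty]; simp

lemma osc_empty : osc n c ∅ = 0 := by simp [osc, Up_empty]

lemma osc_univ (hn : 1 ≤ n) : osc n c Set.univ = 0 := by
  rw [osc]
  have : Lo n c Set.univ = 1 := by
    have := Up_add (c := c) hn ∅
    rwa [Up_empty, zero_add, Set.compl_empty] at this
  rw [this]
  exact tsub_eq_zero_of_le (Up_le_one _)

lemma osc_decided (hn : 1 ≤ n) (T : Set (AT n))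
    (h : (∀ t : Nd n c, t.1 ∈ T) ∨ (∀ t : Nd n c, t.1 ∉ T)) : osc n c T = 0 := by
  rcases h with h | h
  · rw [← osc_univ (c := c) hn, osc, osc, Up, Lo, Up, Lo, q_congr (T' := Set.univ) (by simpa using h)]
  · rw [← osc_empty (c := c), osc, osc, Up, Lo, Up, Lo, q_congr (T' := ∅) (by simpa using h)]

lemma limsup_add_le_aux {u v : ℕ → ℝ≥0∞} :
    limsup (fun m => u m + v m) atTop ≤ limsup u atTop + limsup v atTop := by
  refine ENNReal.le_of_forall_pos_le_add fun ε hε hfin => ?_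
  have h1 : limsup u atTop < limsup u atTop + ε / 2 := by
    refine ENNReal.lt_add_right (ne_top_of_le_ne_top hfin.ne le_self_add) ?_
    simp [hε.ne']
  have h2 : limsup v atTop < limsup v atTop + ε / 2 := by
    refine ENNReal.lt_add_right (ne_top_of_le_ne_top hfin.ne le_add_self) ?_
    simp [hε.ne']
  refine limsup_le_of_le (h := ?_)
  filter_upwards [eventually_lt_of_limsup_lt h1, eventually_lt_of_limsup_lt h2] with m a b
  refine (add_le_add a.le b.le).trans (le_of_eq ?_)
  rw [add_add_add_comm, ENNReal.add_halves]

lemma Up_union (T T' : Set (AT n)) : Up n c (T ∪ T') ≤ Up n c T + Up n c T' := by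
  classical
  refine le_trans ?_ limsup_add_le_aux
  refine limsup_le_limsup (Eventually.of_forall fun m => ?_)
  simp only [q]
  rw [← ENNReal.add_div, Q, Q, Q, ← ENNReal.tsum_add]
  gcongr with t
  by_cases h1 : size t.1 = m <;> by_cases h2 : t.1 ∈ T <;> by_cases h3 : t.1 ∈ T' <;> simp [h1, h2, h3]

lemma osc_tendsto (T : Set (AT n)) (h : osc n c T = 0) :
    Tendsto (q n c T) atTop (𝓝 (Up n c T)) := by
  have := tsub_eq_zero_iff_le.1 h
  exact tendsto_of_liminf_eq_limsup (le_antisymm (Lo_le_Up T) this) rfl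

end ctx


end part5

section part6

open Filter Topology AT
open scoped ENNReal

section exist
variable {n : ℕ} {c : Bool}

/-- connective as operation -/
def bop (c a b : Bool) : Bool := if c then a && b else a || b

lemma evalList_append (c : Bool) (a b : List (AT n)) (x : Fin n → Bool) :
    evalList c (a ++ b) x = bop c (evalList c a x) (evalList c b x) := by
  induction a with
  | nil => cases c <;> simp [evalList, bop]
  | cons t a ih => cases c <;> simp [evalList, bop, ih, Bool.and_assoc, Bool.or_assoc]

/-- trees whose function belongs to a set -/
def evS (S : Set ((Fin n → Bool) → Bool)) : Set (AT n) := {t | eval t ∈ S}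

/-- induced set of functions -/
def trS (S : Set ((Fin n → Bool) → Bool)) (C : Ctx n c) : Set ((Fin n → Bool) → Bool) :=
  {g | (fun x => bop c (evalList c (C.1.map Subtype.val) x)
    (bop c (g x) (evalList c (C.2.map Subtype.val) x))) ∈ S}

lemma tr_evS (S : Set ((Fin n → Bool) → Bool)) (C : Ctx n c) : tr (evS S) C = evS (trS S C) := by
  ext t
  simp only [tr, evS, trS, Set.mem_ofPred_eq]
  suffices h : eval (plug C t) = (fun x => bop c (evalList c (C.1.map Subtype.val) x)
    (bop c (eval t x) (evalList c (C.2.map Subtype.val) x))) by rw [h]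
  funext x
  rw [plug, eval, evalList_append]
  cases c <;> simp [bop, evalList]

/-- a context forcing the value -/
def C0 (i : Fin n) (c : Bool) : Ctx n c := ([lf c (i, true), lf c (i, false)], [])

lemma eval_C0 (i : Fin n) (t : AT n) : eval (plug (C0 i c) t) = fun _ => !c := by
  funext x
  simp only [plug, C0, eval, evalList, lf, List.map_cons, List.map_nil, List.cons_append,
    List.nil_append]
  cases c <;> cases x i <;> simp

lemma mu_C0 (i : Fin n) : mu (C0 i c) = rE n ^ 3 := by
  simp [mu, C0, csz, lf, size]

lemma osc_evS_aux (hn : 1 ≤ n) (c : Bool) (S : Set ((Fin n → Bool) → Bool)) :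
    osc n c (evS S) = 0 := by
  classical
  let i : Fin n := ⟨0, hn⟩
  set D : ℝ≥0∞ := ⨆ (p : Bool × Set ((Fin n → Bool) → Bool)), osc n p.1 (evS p.2) with hD
  have hle : ∀ c S, osc n c (evS S) ≤ D := fun c S =>
    le_iSup (fun p : Bool × Set ((Fin n → Bool) → Bool) => osc n p.1 (evS p.2)) (c, S)
  have hD1 : D ≤ 1 := iSup_le fun p => osc_le_one _
  have hDt : D ≠ ⊤ := ne_top_of_le_ne_top ENNReal.one_ne_top hD1
  have hr3 : rE n ^ 3 * D ≠ ⊤ := ENNReal.mul_ne_top (ENNReal.pow_ne_top (rE_ne_top n)) hDt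
  have key : ∀ c S, osc n c (evS S) + rE n ^ 3 * D ≤ D := by
    intro c S
    calc osc n c (evS S) + rE n ^ 3 * D
        ≤ ∑' C : Ctx n c, mu C * osc n (!c) (tr (evS S) C) +
          ∑' C : Ctx n c, (if C = C0 i c then rE n ^ 3 * D else 0) := by
          rw [tsum_ite_eq]
          gcongr
          exact osc_ctx hn _
      _ = ∑' C : Ctx n c, (mu C * osc n (!c) (tr (evS S) C) +
          (if C = C0 i c then rE n ^ 3 * D else 0)) := by rw [ENNReal.tsum_add]
      _ ≤ ∑' C : Ctx n c, mu C * D := by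
          refine ENNReal.tsum_le_tsum fun C => ?_
          by_cases h : C = C0 i c
          · subst h
            have : osc n (!c) (tr (evS S) (C0 i c)) = 0 := by
              apply osc_decided hn
              by_cases h2 : (fun _ => !c) ∈ S
              · left; intro t
                simpa [tr, evS, eval_C0] using h2
              · right; intro t
                simpa [tr, evS, eval_C0] using h2
            rw [this, if_pos rfl, mu_C0]; simp
          · rw [if_neg h, add_zero, tr_evS]
            gcongr
            exact hle _ _
      _ = D := by rw [ENNReal.tsum_mul_right, tsum_mu hn, one_mul]
  have h2 : D ≤ D - rE n ^ 3 * D := iSup_le fun p => ENNReal.le_sub_of_add_le_right hr3 (key _ _)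
  have h3 : rE n ^ 3 * D ≤ D := le_trans le_add_self (key c S)
  have h4 : D + rE n ^ 3 * D ≤ D := by
    calc D + rE n ^ 3 * D ≤ (D - rE n ^ 3 * D) + rE n ^ 3 * D := by gcongr
      _ = D := tsub_add_cancel_of_le h3
  have h5 : rE n ^ 3 * D = 0 := by
    have : D + rE n ^ 3 * D ≤ D + 0 := by simpa using h4
    simpa using (ENNReal.add_le_add_iff_left hDt).1 this
  have h6 : D = 0 := by
    rcases mul_eq_zero.1 h5 with h | h
    · exact absurd h (pow_ne_zero _ (rE_ne_zero hn))
    · exact h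
  exact le_antisymm (h6 ▸ hle c S) zero_le

/-- tautologies -/
def Taut (n : ℕ) : Set (AT n) := {t | eval t = fun _ => true}

lemma osc_taut (hn : 1 ≤ n) (c : Bool) : osc n c (Taut n) = 0 := osc_evS_aux hn c {fun _ => true}

lemma simple_not (t : Nd n true) : t.1 ∉ SimpleTauto n := by
  rintro ⟨h, -⟩
  rw [t.2.2] at h; simp at h

lemma leaf_mem_plug (C : Ctx n c) (t : Nd n (!c)) (i : Fin n) (b : Bool) :
    AT.leaf i b ∈ rootChildren (plug C t.1) ↔
      AT.leaf i b ∈ (C.1.map Subtype.val ++ C.2.map Subtype.val) := by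
  have : AT.leaf i b ≠ t.1 := by
    intro h
    have := t.2.2
    rw [← h] at this
    simp [rootConn] at this
  simp only [plug, rootChildren, List.mem_append, List.mem_cons, this, false_or]

lemma osc_simple (hn : 1 ≤ n) (c : Bool) : osc n c (SimpleTauto n) = 0 := by
  cases c with
  | true => exact osc_decided hn _ (Or.inr simple_not)
  | false =>
    refine le_antisymm ((osc_ctx hn _).trans (le_of_eq ?_)) zero_le
    rw [ENNReal.tsum_eq_zero]
    intro C
    rw [osc_decided hn, mul_zero]
    by_cases h : ∃ i : Fin n, AT.leaf i true ∈ (C.1.map Subtype.val ++ C.2.map Subtype.val) ∧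
      AT.leaf i false ∈ (C.1.map Subtype.val ++ C.2.map Subtype.val)
    · left
      intro t
      obtain ⟨i, h1, h2⟩ := h
      exact ⟨rfl, i, (leaf_mem_plug C t i true).2 h1, (leaf_mem_plug C t i false).2 h2⟩
    · right
      rintro t ⟨-, i, h1, h2⟩
      exact h ⟨i, (leaf_mem_plug C t i true).1 h1, (leaf_mem_plug C t i false).1 h2⟩

lemma Q_card (T : Set (AT n)) (m : ℕ) :
    Finite {t : Nd n c // size t.1 = m ∧ t.1 ∈ T} ∧
    Q n c T m = (Nat.card {t : Nd n c // size t.1 = m ∧ t.1 ∈ T} : ℕ) := by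
  classical
  have h : Q n c T m = ∑' _ : {t : Nd n c // size t.1 = m ∧ t.1 ∈ T}, (1:ℝ≥0∞) := by
    refine Eq.trans ?_ (tsum_subtype {t : Nd n c | size t.1 = m ∧ t.1 ∈ T}
      (fun _ => (1:ℝ≥0∞))).symm
    rw [Q]
    congr 1; funext t
    by_cases h : size t.1 = m ∧ t.1 ∈ T
    · rw [if_pos h, Set.indicator_of_mem (by exact h)]
    · rw [if_neg h, Set.indicator_of_notMem (by exact h)]
  rw [ENNReal.tsum_const, mul_one] at h
  have hfin : Finite {t : Nd n c // size t.1 = m ∧ t.1 ∈ T} := by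
    rw [← ENat.card_lt_top]
    have h2 := ne_top_of_le_ne_top (nu_ne_top m) (Q_le (c := c) T m)
    rw [h] at h2
    rw [lt_top_iff_ne_top]
    intro h3; rw [h3] at h2; simp at h2
  refine ⟨hfin, ?_⟩
  rw [h, ENat.card_eq_coe_natCard]; simp

lemma countIn_eq (T : Set (AT n)) {m : ℕ} (hm : 2 ≤ m) :
    (countIn n T m : ℝ≥0∞) = Q n true T m + Q n false T m := by
  have h1 := Q_card (c := true) T m
  have h2 := Q_card (c := false) T m
  have := h1.1
  have := h2.1
  rw [h1.2, h2.2, ← Nat.cast_add, ← Nat.card_sum, countIn]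
  congr 1
  symm
  refine Nat.card_congr (Equiv.ofBijective
    (Sum.elim (fun t => ⟨t.1.1, t.2.2, t.1.2.1, t.2.1⟩) (fun t => ⟨t.1.1, t.2.2, t.1.2.1, t.2.1⟩)) ?_)
  constructor
  · rintro (⟨⟨t, h, h'⟩, h2⟩ | ⟨⟨t, h, h'⟩, h2⟩) (⟨⟨t', g, g'⟩, g2⟩ | ⟨⟨t', g, g'⟩, g2⟩) e
    all_goals
      simp only [Sum.elim_inl, Sum.elim_inr, Subtype.mk.injEq] at e
      subst e
      first
        | rfl
        | (exfalso; rw [h'] at g'; simp at g')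
  · rintro ⟨t, h1, h2, h3⟩
    cases t with
    | leaf i b => simp [size] at h3; omega
    | node c ts =>
      cases c
      · exact ⟨Sum.inr ⟨⟨_, h2, rfl⟩, h3, h1⟩, rfl⟩
      · exact ⟨Sum.inl ⟨⟨_, h2, rfl⟩, h3, h1⟩, rfl⟩

lemma Q_univ (m : ℕ) : Q n c Set.univ m = nu n m := by
  have := Q_compl (c := c) (Set.univ : Set (AT n)) m
  rw [← this, Set.compl_univ]
  simp [Q]

lemma ratio_eq (T : Set (AT n)) {m : ℕ} (hm : 2 ≤ m) :
    ratio n T m = ((q n true T m + q n false T m) / 2).toReal := by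
  have h1 := countIn_eq T hm
  have h2 := countIn_eq (Set.univ : Set (AT n)) hm
  rw [Q_univ, Q_univ] at h2
  rw [ratio, A, ← ENNReal.toReal_natCast, ← ENNReal.toReal_natCast (countIn n Set.univ m), h1, h2,
    ← ENNReal.toReal_div]
  congr 1
  rw [q, q, ← ENNReal.add_div, ← two_mul]
  simp only [div_eq_mul_inv]
  rw [ENNReal.mul_inv (by simp) (by simp), mul_assoc, mul_comm (2:ℝ≥0∞)⁻¹]

lemma ratio_tendsto (T : Set (AT n)) (h : ∀ c, osc n c T = 0) :
    Tendsto (ratio n T) atTop (𝓝 ((Up n true T + Up n false T) / 2).toReal) := by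
  have h1 := (osc_tendsto T (h true)).add (osc_tendsto T (h false))
  have h2 := ENNReal.Tendsto.div_const h1 (b := 2) (by right; simp)
  have h3 := (ENNReal.tendsto_toReal (a := (Up n true T + Up n false T) / 2) ?_).comp h2
  · refine h3.congr' ?_
    filter_upwards [eventually_ge_atTop 2] with m hm
    rw [ratio_eq T hm]; rfl
  · refine (ENNReal.div_lt_top ?_ (by simp)).ne
    refine ENNReal.add_ne_top.2 ⟨?_, ?_⟩ <;>
      exact ne_top_of_le_ne_top ENNReal.one_ne_top (Up_le_one _)

lemma simple_sub : SimpleTauto n ⊆ Taut n := by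
  rintro t ⟨h, i, h1, h2⟩
  cases t with
  | leaf i b => simp [rootConn] at h
  | node c ts =>
    simp only [rootConn, Option.some.injEq] at h
    subst h
    simp only [rootChildren] at h1 h2
    have key : ∀ (l : List (AT n)) (t : AT n) (x : Fin n → Bool), t ∈ l → eval t x = true →
        evalList false l x = true := by
      intro l t x hl hx
      induction l with
      | nil => simp at hl
      | cons a l ih =>
        simp only [evalList, Bool.false_eq_true, if_false, Bool.or_eq_true]
        rcases List.mem_cons.1 hl with rfl | hl
        · left; exact hx
        · right; exact ih hl
    funext x
    rw [eval]
    cases hx : x i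
    · exact key ts _ x h2 (by simp [eval, hx])
    · exact key ts _ x h1 (by simp [eval, hx])

lemma diff_bound :
    |((Up n true (Taut n) + Up n false (Taut n)) / 2).toReal -
      ((Up n true (SimpleTauto n) + Up n false (SimpleTauto n)) / 2).toReal| ≤
    (Up n true (Taut n) + Up n false (Taut n \ SimpleTauto n)).toReal := by
  have f : ∀ c T, Up n c T ≠ ⊤ := fun c T => ne_top_of_le_ne_top ENNReal.one_ne_top (Up_le_one T)
  have h0 : Up n true (SimpleTauto n) = 0 := by
    refine le_antisymm ?_ zero_le
    rw [← Up_empty (n := n) (c := true)]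
    exact Up_mono fun t ht => (simple_not t ht).elim
  have h1 : Up n false (SimpleTauto n) ≤ Up n false (Taut n) := Up_mono fun t ht => simple_sub ht
  have h2 : Up n false (Taut n) ≤ Up n false (SimpleTauto n) +
      Up n false (Taut n \ SimpleTauto n) := by
    refine le_trans (Up_mono fun t ht => ?_) (Up_union _ _)
    by_cases h : t.1 ∈ SimpleTauto n
    · exact Or.inl h
    · exact Or.inr ⟨ht, h⟩
  rw [h0, zero_add]
  have h1' := ENNReal.toReal_mono (f _ _) h1
  have h2' := ENNReal.toReal_mono (ENNReal.add_ne_top.2 ⟨f _ _, f _ _⟩) h2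
  rw [ENNReal.toReal_add (f _ _) (f _ _)] at h2'
  rw [ENNReal.toReal_div, ENNReal.toReal_div, ENNReal.toReal_add (f _ _) (f _ _),
    ENNReal.toReal_add (f _ _) (f _ _)]
  have p1 : 0 ≤ (Up n true (Taut n)).toReal := ENNReal.toReal_nonneg
  have p2 : 0 ≤ (Up n false (Taut n \ SimpleTauto n)).toReal := ENNReal.toReal_nonneg
  simp only [ENNReal.toReal_ofNat]
  rw [abs_le]; constructor <;> linarith

end exist


end part6

section part7

open Filter Topology AT
open scoped ENNReal

section sums

open Classical in
/-- indicator of a proposition -/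
noncomputable def ind (P : Prop) : ℝ≥0∞ := if P then 1 else 0

lemma ind_pos {P : Prop} (h : P) : ind P = 1 := if_pos h
lemma ind_neg {P : Prop} (h : ¬ P) : ind P = 0 := if_neg h
lemma ind_le_one (P : Prop) : ind P ≤ 1 := by unfold ind; split_ifs <;> simp
lemma ind_mono {P P' : Prop} (h : P → P') : ind P ≤ ind P' := by
  by_cases hp : P
  · rw [ind_pos hp, ind_pos (h hp)]
  · rw [ind_neg hp]; exact zero_le
lemma ind_or (P P' : Prop) : ind (P ∨ P') ≤ ind P + ind P' := by
  by_cases hp : P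
  · rw [ind_pos hp]; exact (ind_le_one _).trans le_self_add
  · rw [ind_neg hp, zero_add]; exact ind_mono (by tauto)
lemma of_ind_ne {P : Prop} {a : ℝ≥0∞} (h : ind P * a ≠ 0) : P := by
  by_contra hp
  rw [ind_neg hp, zero_mul] at h
  exact h rfl

lemma cover {α β : Type*} (φ : α → ℝ≥0∞) (ψ : β → ℝ≥0∞) (π : β → α)
    (h : ∀ x, φ x ≠ 0 → ∃ y, π y = x ∧ φ x ≤ ψ y) : ∑' x, φ x ≤ ∑' y, ψ y := by
  classical
  choose g hg using h
  have e : ∑' x, φ x = ∑' x : Function.support φ, φ x := by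
    rw [tsum_subtype (Function.support φ) φ, Set.indicator_support]
  rw [e]
  have hinj : Function.Injective (fun x : Function.support φ => g x.1 x.2) := by
    rintro ⟨x, hx⟩ ⟨y, hy⟩ hxy
    apply Subtype.ext
    have h1 := (hg x hx).1
    have h2 := (hg y hy).1
    simp only at hxy ⊢
    rw [← h1, ← h2, hxy]
  refine le_trans ?_ (ENNReal.tsum_comp_le_tsum_of_injective hinj ψ)
  exact ENNReal.tsum_le_tsum fun x => (hg x.1 x.2).2

variable {n : ℕ} {c : Bool}

/-- weight of the children satisfying a predicate -/
noncomputable def wP (P : Ch n c → Prop) : ℝ≥0∞ := ∑' u : Ch n c, ind (P u) * rE n ^ size u.1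
/-- weight of the pairs of children satisfying a relation -/
noncomputable def wR (R : Ch n c → Ch n c → Prop) : ℝ≥0∞ :=
  ∑' u : Ch n c, ∑' v : Ch n c, ind (R u v) * (rE n ^ size u.1 * rE n ^ size v.1)

lemma mem_sum (P : Ch n c → Prop) :
    ∑' l : List (Ch n c), ind (∃ u ∈ l, P u) * rE n ^ ls l ≤ wP P * (wL n c * wL n c) := by
  have e : wP P * (wL n c * wL n c) = ∑' p : Ch n c × List (Ch n c) × List (Ch n c),
      ind (P p.1) * rE n ^ size p.1.1 * (rE n ^ ls p.2.1 * rE n ^ ls p.2.2) := by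
    rw [ENNReal.tsum_prod']
    simp_rw [ENNReal.tsum_prod', ENNReal.tsum_mul_left, ENNReal.tsum_mul_right]
    rfl
  rw [e]
  refine cover _ _ (fun p => p.2.1 ++ p.1 :: p.2.2) fun l hl => ?_
  obtain ⟨u, hu, hP⟩ := of_ind_ne hl
  obtain ⟨a, b, rfl⟩ := List.append_of_mem hu
  refine ⟨(u, a, b), rfl, ?_⟩
  rw [ind_pos hP, one_mul]
  refine (mul_le_mul_left (ind_le_one _) _).trans (le_of_eq ?_)
  rw [ls_append, ls_cons, pow_add, pow_add]; ring

lemma ord_sum (R : Ch n c → Ch n c → Prop) :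
    ∑' l : List (Ch n c), ind (∃ a u b v d, l = a ++ u :: (b ++ v :: d) ∧ R u v) * rE n ^ ls l ≤
      wR R * (wL n c * (wL n c * wL n c)) := by
  have e : wR R * (wL n c * (wL n c * wL n c)) =
      ∑' p : Ch n c × Ch n c × List (Ch n c) × List (Ch n c) × List (Ch n c),
      ind (R p.1 p.2.1) * (rE n ^ size p.1.1 * rE n ^ size p.2.1.1) *
      (rE n ^ ls p.2.2.1 * (rE n ^ ls p.2.2.2.1 * rE n ^ ls p.2.2.2.2)) := by
    rw [ENNReal.tsum_prod']
    simp_rw [ENNReal.tsum_prod', ENNReal.tsum_mul_left, ENNReal.tsum_mul_right]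
    rfl
  rw [e]
  refine cover _ _ (fun p => p.2.2.1 ++ p.1 :: (p.2.2.2.1 ++ p.2.1 :: p.2.2.2.2)) fun l hl => ?_
  obtain ⟨a, u, b, v, d, rfl, hR⟩ := of_ind_ne hl
  refine ⟨(u, v, a, b, d), rfl, ?_⟩
  rw [ind_pos hR, one_mul]
  refine (mul_le_mul_left (ind_le_one _) _).trans (le_of_eq ?_)
  simp only [ls_append, ls_cons, pow_add]; ring

lemma wR_swap (R : Ch n c → Ch n c → Prop) : wR (fun u v => R v u) = wR R := by
  rw [wR, wR, ENNReal.tsum_comm]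
  simp only [mul_comm]

lemma pair_sum (R : Ch n c → Ch n c → Prop) (hR : ∀ u, ¬ R u u) :
    ∑' l : List (Ch n c), ind (∃ u ∈ l, ∃ v ∈ l, R u v) * rE n ^ ls l ≤
      2 * (wR R * (wL n c * (wL n c * wL n c))) := by
  have h1 := ord_sum R
  have h2 := ord_sum (fun u v => R v u)
  rw [wR_swap] at h2
  rw [two_mul]
  refine le_trans ?_ (add_le_add h1 h2)
  rw [← ENNReal.tsum_add]
  refine ENNReal.tsum_le_tsum fun l => ?_
  rw [← add_mul]
  refine mul_le_mul_left (le_trans (ind_mono ?_) (ind_or _ _)) _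
  rintro ⟨u, hu, v, hv, h⟩
  obtain ⟨a, b, rfl⟩ := List.append_of_mem hu
  simp only [List.mem_append, List.mem_cons] at hv
  rcases hv with hv | rfl | hv
  · obtain ⟨a, a', rfl⟩ := List.append_of_mem hv
    right
    exact ⟨a, v, a', u, b, by simp, h⟩
  · exact absurd h (hR _)
  · obtain ⟨b, b', rfl⟩ := List.append_of_mem hv
    left
    exact ⟨a, u, b, v, b', rfl, h⟩

lemma cross_sum (R : Ch n c → Ch n c → Prop) :
    ∑' l : List (Ch n c), ∑' r : List (Ch n c),
      ind (∃ u ∈ l, ∃ v ∈ r, R u v) * (rE n ^ ls l * rE n ^ ls r) ≤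
      wR R * (wL n c * (wL n c * (wL n c * wL n c))) := by
  have e : wR R * (wL n c * (wL n c * (wL n c * wL n c))) =
      ∑' p : Ch n c × Ch n c × List (Ch n c) × List (Ch n c) × List (Ch n c) × List (Ch n c),
      ind (R p.1 p.2.1) * (rE n ^ size p.1.1 * rE n ^ size p.2.1.1) *
      (rE n ^ ls p.2.2.1 * (rE n ^ ls p.2.2.2.1 * (rE n ^ ls p.2.2.2.2.1 *
        rE n ^ ls p.2.2.2.2.2))) := by
    rw [ENNReal.tsum_prod']
    simp_rw [ENNReal.tsum_prod', ENNReal.tsum_mul_left, ENNReal.tsum_mul_right]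
    rfl
  rw [e, ← ENNReal.tsum_prod (f := fun l r =>
    ind (∃ u ∈ l, ∃ v ∈ r, R u v) * (rE n ^ ls l * rE n ^ ls r))]
  refine cover _ _ (fun p => (p.2.2.1 ++ p.1 :: p.2.2.2.1,
    p.2.2.2.2.1 ++ p.2.1 :: p.2.2.2.2.2)) fun ⟨l, r⟩ hl => ?_
  obtain ⟨u, hu, v, hv, h⟩ := of_ind_ne hl
  obtain ⟨a, b, rfl⟩ := List.append_of_mem hu
  obtain ⟨a', b', rfl⟩ := List.append_of_mem hv
  refine ⟨(u, v, a, b, a', b'), rfl, ?_⟩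
  rw [ind_pos h, one_mul]
  refine (mul_le_mul_left (ind_le_one _) _).trans (le_of_eq ?_)
  simp only [ls_append, ls_cons, pow_add]; ring

/-- weight of a context, with the root -/
noncomputable def wX (C : Ctx n c) : ℝ≥0∞ := rE n ^ (1 + csz C)

lemma wX_eq (l r : List (Ch n c)) : wX (l, r) = rE n * (rE n ^ ls l * rE n ^ ls r) := by
  simp [wX, csz, pow_add]

lemma ctx_left (f : List (Ch n c) → ℝ≥0∞) :
    ∑' C : Ctx n c, f C.1 * wX C = rE n * wL n c * ∑' l, f l * rE n ^ ls l := by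
  rw [ENNReal.tsum_prod']
  have : ∀ l r : List (Ch n c), f l * wX (l, r) = rE n * (f l * rE n ^ ls l) * rE n ^ ls r := by
    intro l r; rw [wX_eq]; ring
  simp_rw [this, ENNReal.tsum_mul_left, ENNReal.tsum_mul_right, ENNReal.tsum_mul_left]
  rw [← wL]; ring

lemma ctx_right (f : List (Ch n c) → ℝ≥0∞) :
    ∑' C : Ctx n c, f C.2 * wX C = rE n * wL n c * ∑' l, f l * rE n ^ ls l := by
  rw [ENNReal.tsum_prod', ENNReal.tsum_comm]
  have : ∀ r l : List (Ch n c), f r * wX (l, r) = rE n * (f r * rE n ^ ls r) * rE n ^ ls l := by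
    intro l r; rw [wX_eq]; ring
  simp_rw [this, ENNReal.tsum_mul_left, ENNReal.tsum_mul_right, ENNReal.tsum_mul_left]
  rw [← wL]; ring

lemma ctx_mem (P : Ch n c → Prop) :
    ∑' C : Ctx n c, ind (∃ u ∈ C.1 ++ C.2, P u) * wX C ≤
      2 * (rE n * wL n c ^ 3 * wP P) := by
  calc _ ≤ ∑' C : Ctx n c, (ind (∃ u ∈ C.1, P u) * wX C + ind (∃ u ∈ C.2, P u) * wX C) := by
        refine ENNReal.tsum_le_tsum fun C => ?_
        rw [← add_mul]
        refine mul_le_mul_left (le_trans (ind_mono ?_) (ind_or _ _)) _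
        rintro ⟨u, hu, h⟩
        rcases List.mem_append.1 hu with hu | hu
        · exact Or.inl ⟨u, hu, h⟩
        · exact Or.inr ⟨u, hu, h⟩
    _ ≤ rE n * wL n c * (wP P * (wL n c * wL n c)) +
        rE n * wL n c * (wP P * (wL n c * wL n c)) := by
        rw [ENNReal.tsum_add, ctx_left (fun l => ind (∃ u ∈ l, P u)),
          ctx_right (fun l => ind (∃ u ∈ l, P u))]
        gcongr <;> exact mem_sum P
    _ = _ := by ring

lemma ctx_cross (R : Ch n c → Ch n c → Prop) :
    ∑' C : Ctx n c, ind (∃ u ∈ C.1, ∃ v ∈ C.2, R u v) * wX C ≤ rE n * wL n c ^ 4 * wR R := by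
  rw [ENNReal.tsum_prod']
  have : ∀ l r : List (Ch n c), ind (∃ u ∈ l, ∃ v ∈ r, R u v) * wX (l, r) =
      rE n * (ind (∃ u ∈ l, ∃ v ∈ r, R u v) * (rE n ^ ls l * rE n ^ ls r)) := by
    intro l r; rw [wX_eq]; ring
  simp_rw [this, ENNReal.tsum_mul_left]
  calc _ ≤ rE n * (wR R * (wL n c * (wL n c * (wL n c * wL n c)))) := by
        gcongr; exact cross_sum R
    _ = _ := by ring

lemma ctx_pair (R : Ch n c → Ch n c → Prop) (hR : ∀ u, ¬ R u u) :
    ∑' C : Ctx n c, ind (∃ u ∈ C.1 ++ C.2, ∃ v ∈ C.1 ++ C.2, R u v) * wX C ≤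
      6 * (rE n * wL n c ^ 4 * wR R) := by
  calc _ ≤ ∑' C : Ctx n c, (ind (∃ u ∈ C.1, ∃ v ∈ C.1, R u v) * wX C +
          (ind (∃ u ∈ C.2, ∃ v ∈ C.2, R u v) * wX C +
          (ind (∃ u ∈ C.1, ∃ v ∈ C.2, R u v) * wX C +
          ind (∃ u ∈ C.1, ∃ v ∈ C.2, R v u) * wX C))) := by
        refine ENNReal.tsum_le_tsum fun C => ?_
        simp only [← add_mul]
        refine mul_le_mul_left (le_trans (ind_mono ?_) (le_trans (ind_or _ _)
          (add_le_add le_rfl (le_trans (ind_or _ _) (add_le_add le_rfl (ind_or _ _)))))) _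
        rintro ⟨u, hu, v, hv, h⟩
        rcases List.mem_append.1 hu with hu | hu <;> rcases List.mem_append.1 hv with hv | hv
        · exact Or.inl ⟨u, hu, v, hv, h⟩
        · exact Or.inr (Or.inr (Or.inl ⟨u, hu, v, hv, h⟩))
        · exact Or.inr (Or.inr (Or.inr ⟨v, hv, u, hu, h⟩))
        · exact Or.inr (Or.inl ⟨u, hu, v, hv, h⟩)
    _ ≤ rE n * wL n c * (2 * (wR R * (wL n c * (wL n c * wL n c)))) +
        (rE n * wL n c * (2 * (wR R * (wL n c * (wL n c * wL n c)))) +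
        (rE n * wL n c ^ 4 * wR R + rE n * wL n c ^ 4 * wR R)) := by
        rw [ENNReal.tsum_add, ENNReal.tsum_add, ENNReal.tsum_add,
          ctx_left (fun l => ind (∃ u ∈ l, ∃ v ∈ l, R u v)),
          ctx_right (fun l => ind (∃ u ∈ l, ∃ v ∈ l, R u v))]
        gcongr
        · exact pair_sum R hR
        · exact pair_sum R hR
        · exact ctx_cross R
        · rw [← wR_swap R]; exact ctx_cross (fun u v => R v u)
    _ = _ := by ring

lemma Up_le_ctx (hn : 1 ≤ n) (T : Set (AT n)) (g : Ctx n c → ℝ≥0∞)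
    (h : ∀ C, Up n (!c) (tr T C) ≤ g C) : Up n c T ≤ ∑' C, mu C * g C := by
  refine (Up_ctx hn T).trans (ENNReal.tsum_le_tsum fun C => ?_)
  gcongr
  exact h C

lemma mu_le (C : Ctx n c) : mu C ≤ wX C := by
  rw [mu, wX]; split_ifs <;> simp

end sums


end part7

section part8

open Filter Topology AT
open scoped ENNReal

/-- literal of the first child of the root, if it is a leaf -/
def hd {n : ℕ} : AT n → Option (Fin n × Bool)
  | .node _ (.leaf i b :: _) => some (i, b)
  | _ => none

/-- literal of a leaf, or of the first child -/
def fl {n : ℕ} : AT n → Option (Fin n × Bool)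
  | .leaf i b => some (i, b)
  | .node c ts => hd (.node c ts)

/-- complementary literal -/
def cmpl {n : ℕ} (p : Fin n × Bool) : Fin n × Bool := (p.1, !p.2)

section structural
variable {n : ℕ} {c : Bool}

lemma hd_none (a : AT n) (ts : List (AT n)) : hd (.node c (a :: ts)) = none ↔ isLeafB a = false := by
  cases a <;> simp [hd, isLeafB]

lemma hd_some (a : AT n) (ts : List (AT n)) (q : Fin n × Bool) :
    hd (.node c (a :: ts)) = some q ↔ a = .leaf q.1 q.2 := by
  cases a
  · simp [hd, Prod.ext_iff]
  · simp [hd]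

lemma nd_notLeaf (t : Nd n c) : isLeafB t.1 = false := by
  obtain ⟨t, h1, h2⟩ := t
  cases t
  · simp [rootConn] at h2
  · rfl

lemma fl_nd (t : Nd n c) : fl t.1 = hd t.1 := by
  obtain ⟨t, h1, h2⟩ := t
  cases t
  · simp [rootConn] at h2
  · rfl

lemma evalList_false {l : List (AT n)} {x : Fin n → Bool} (h : ∀ u ∈ l, eval u x = false) :
    evalList false l x = false := by
  induction l with
  | nil => rfl
  | cons a l ih =>
    simp only [evalList, Bool.false_eq_true, if_false, Bool.or_eq_false_iff]
    exact ⟨h a (by simp), ih fun u hu => h u (by simp [hu])⟩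

lemma hd_false {ts : List (AT n)} {x : Fin n → Bool} {i : Fin n} {b : Bool}
    (h : hd (.node true ts) = some (i, b)) (hx : x i = !b) : eval (.node true ts) x = false := by
  match ts with
  | [] => simp [hd] at h
  | a :: ts =>
    rw [hd_some] at h
    subst h
    cases b <;> simp [eval, evalList, hx]

lemma fl_false (u : Ch n false) {x : Fin n → Bool} {i : Fin n} {b : Bool}
    (h : fl u.1 = some (i, b)) (hx : x i = !b) : eval u.1 x = false := by
  obtain ⟨u, h1, h2⟩ := u
  cases u with
  | leaf j d =>
    simp only [fl, Option.some.injEq, Prod.mk.injEq] at h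
    obtain ⟨rfl, rfl⟩ := h
    cases d <;> simp [eval, hx]
  | node d ts =>
    simp only [rootConn, ne_eq, Option.some.injEq, Bool.not_eq_false] at h2
    subst h2
    exact hd_false h hx

lemma all_false (L : List (Ch n false)) (h1 : ∀ u ∈ L, ∃ q, fl u.1 = some q)
    (h2 : ∀ u ∈ L, ∀ v ∈ L, ∀ q, fl u.1 = some q → fl v.1 ≠ some (cmpl q)) :
    ∃ x, evalList false (L.map Subtype.val) x = false := by
  classical
  refine ⟨fun i => decide (∃ u ∈ L, fl u.1 = some (i, false)), evalList_false ?_⟩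
  intro u hu0
  obtain ⟨u, hu, rfl⟩ := List.mem_map.1 hu0
  obtain ⟨⟨i, b⟩, hq⟩ := h1 u hu
  refine fl_false u hq ?_
  cases b with
  | false => simpa using ⟨u.1, ⟨u.2, hu⟩, hq⟩
  | true =>
    simp only [Bool.not_true, decide_eq_false_iff_not]
    rintro ⟨v, hv, hvq⟩
    exact h2 u hu v hv _ hq (by simpa [cmpl] using hvq)

/-- the two kinds of bad situations -/
def bad1 (u : Ch n false) : Prop := isLeafB u.1 = false ∧ hd u.1 = none
/-- complementary pair with a nonleaf -/
def bad2 (u v : Ch n false) : Prop :=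
  isLeafB u.1 = false ∧ ∃ q, fl u.1 = some q ∧ fl v.1 = some (cmpl q)

lemma cmpl_cmpl (q : Fin n × Bool) : cmpl (cmpl q) = q := by simp [cmpl]
lemma cmpl_ne (q : Fin n × Bool) : q ≠ cmpl q := by
  intro h
  have := congrArg Prod.snd h
  simp [cmpl] at this

lemma bad2_irrefl (u : Ch n false) : ¬ bad2 u u := by
  rintro ⟨-, q, h1, h2⟩
  rw [h1] at h2
  exact cmpl_ne q (Option.some.inj h2)

lemma fl_leaf {u : AT n} {q : Fin n × Bool} (h : fl u = some q) (hl : isLeafB u = true) :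
    u = .leaf q.1 q.2 := by
  cases u with
  | leaf i b => simp [fl] at h; subst h; rfl
  | node c ts => simp [isLeafB] at hl

lemma taut_cases (C : Ctx n false) (t : Nd n true) (h : plug C t.1 ∈ Taut n \ SimpleTauto n)
    (h1 : ¬ ∃ u ∈ C.1 ++ C.2, bad1 u) (h2 : ¬ ∃ u ∈ C.1 ++ C.2, ∃ v ∈ C.1 ++ C.2, bad2 u v) :
    hd t.1 = none ∨ ∃ q, (∃ u ∈ C.1 ++ C.2, fl u.1 = some q) ∧ hd t.1 = some (cmpl q) := by
  by_contra hcon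
  push Not at hcon
  obtain ⟨hc1, hc2⟩ := hcon
  obtain ⟨p, hp⟩ := Option.ne_none_iff_exists'.1 hc1
  have hmem : ∀ u, u ∈ C.1 ++ ndc (c := false) t :: C.2 ↔ u = ndc (c := false) t ∨ u ∈ C.1 ++ C.2 := by
    intro u; simp only [List.mem_append, List.mem_cons]; tauto
  have hft : fl (ndc (c := false) t).1 = some p := by
    rw [← hp]; exact fl_nd t
  have hex : ∃ x, evalList false ((C.1 ++ ndc (c := false) t :: C.2).map Subtype.val) x = false := by
    apply all_false
    · intro u hu
      rcases (hmem u).1 hu with rfl | hu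
      · exact ⟨p, hft⟩
      · cases hl : isLeafB u.1
        · by_contra hno
          push Not at hno
          refine h1 ⟨u, hu, hl, ?_⟩
          cases hh : hd u.1 with
          | none => rfl
          | some q =>
            exfalso
            obtain ⟨u, hu1, hu2⟩ := u
            cases u with
            | leaf i b => simp [isLeafB] at hl
            | node c ts => exact hno q hh
        · obtain ⟨u, hu1, hu2⟩ := u
          cases u with
          | leaf i b => exact ⟨_, rfl⟩
          | node c ts => simp [isLeafB] at hl
    · intro u hu v hv q hq hvq
      rcases (hmem u).1 hu with rfl | hu <;> rcases (hmem v).1 hv with rfl | hv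
      · rw [hq] at hvq
        exact cmpl_ne q (Option.some.inj hvq)
      · rw [hft] at hq
        have := Option.some.inj hq
        subst this
        exact hc2 (cmpl p) ⟨v, hv, hvq⟩ (by rw [cmpl_cmpl, hp])
      · rw [hft] at hvq
        have := Option.some.inj hvq
        subst this
        exact hc2 q ⟨u, hu, hq⟩ hp
      · cases hl : isLeafB u.1
        · exact h2 ⟨u, hu, v, hv, hl, q, hq, hvq⟩
        · cases hl' : isLeafB v.1
          · exact h2 ⟨v, hv, u, hu, hl', cmpl q, hvq, by rw [cmpl_cmpl]; exact hq⟩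
          · have e1 := fl_leaf hq hl
            have e2 := fl_leaf hvq hl'
            have m1 : AT.leaf q.1 q.2 ∈ C.1.map Subtype.val ++ C.2.map Subtype.val := by
              rw [← List.map_append, ← e1]; exact List.mem_map_of_mem hu
            have m2 : AT.leaf q.1 (!q.2) ∈ C.1.map Subtype.val ++ C.2.map Subtype.val := by
              rw [← List.map_append]
              have : v.1 = AT.leaf q.1 (!q.2) := e2
              rw [← this]; exact List.mem_map_of_mem hv
            apply h.2
            refine ⟨rfl, q.1, ?_, ?_⟩
            · refine (leaf_mem_plug C t _ _).2 ?_
              cases hb : q.2 <;> rw [hb] at m1 m2 <;> assumption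
            · refine (leaf_mem_plug C t _ _).2 ?_
              cases hb : q.2 <;> rw [hb] at m1 m2 <;> assumption
  obtain ⟨x, hx⟩ := hex
  have ht := congrFun h.1 x
  have e := plug_eq (c := false) C t
  rw [show eval (plug C t.1) x = eval (AT.node false ((C.1 ++ ndc (c := false) t :: C.2).map Subtype.val)) x
    from congrFun (congrArg eval e) x, eval, hx] at ht
  simp at ht

end structural

section bounds
variable {n : ℕ} {c : Bool}

/-- first child not a leaf -/
def E0 (n : ℕ) : Set (AT n) := {t | hd t = none}
/-- first child a given leaf -/
def EL (q : Fin n × Bool) : Set (AT n) := {t | hd t = some q}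

lemma tsum_nonleaf : ∑' a : Ch n c, ind (isLeafB a.1 = false) * rE n ^ size a.1 = wN n (!c) := by
  rw [tsum_ch (fun t => ind (isLeafB t = false) * rE n ^ size t)]
  have h1 : ∑' p : Fin n × Bool, ind (isLeafB (AT.leaf p.1 p.2) = false) *
      rE n ^ size (AT.leaf p.1 p.2) = 0 := by
    rw [ENNReal.tsum_eq_zero]
    intro p
    rw [ind_neg (by simp [isLeafB]), zero_mul]
  rw [h1, zero_add, wN]
  congr 1; funext t
  rw [ind_pos (nd_notLeaf t), one_mul]

lemma tsum_lf (q : Fin n × Bool) :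
    ∑' a : Ch n c, ind (a.1 = AT.leaf q.1 q.2) * rE n ^ size a.1 = rE n := by
  rw [tsum_eq_single (lf c q)]
  · rw [ind_pos (by rfl), one_mul]; simp [lf, size]
  · intro b hb
    rw [ind_neg, zero_mul]
    intro h; exact hb (Subtype.ext h)

lemma tsum_head (p : AT n → Prop) (g : List (Ch n c) → ℝ≥0∞)
    (hg : ∀ a l, g (a :: l) = ind (p a.1)) :
    ∑' l : List (Ch n c), g l * rE n ^ ls l =
      g [] + (∑' a : Ch n c, ind (p a.1) * rE n ^ size a.1) * wL n c := by
  rw [tsum_list]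
  congr 1
  · simp
  · rw [← ENNReal.tsum_mul_right]
    congr 1; funext a
    rw [wL, ← ENNReal.tsum_mul_left]
    congr 1; funext l
    rw [hg, ls_cons, pow_add]; ring

lemma Up_E0 (hn : 1 ≤ n) : Up n c (E0 n) ≤ rE n * wL n c * (1 + wN n (!c) * wL n c) := by
  let g : List (Ch n c) → ℝ≥0∞ := fun l => match l with
    | [] => 1
    | a :: _ => ind (isLeafB a.1 = false)
  have h1 := Up_le_ctx (c := c) hn (E0 n) (fun C => g C.1) (by
    rintro ⟨l, r⟩
    match l with
    | [] => exact Up_le_one _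
    | a :: l =>
      by_cases ha : isLeafB a.1 = false
      · simp only [g]
        rw [ind_pos ha]; exact Up_le_one _
      · refine le_trans (le_of_eq ?_) zero_le
        refine le_antisymm ?_ zero_le
        rw [← Up_empty (n := n) (c := !c)]
        refine Up_mono fun t ht => ?_
        exfalso; apply ha
        simp only [tr, E0, plug, List.map_cons, List.cons_append, Set.mem_ofPred_eq] at ht
        exact (hd_none _ _).1 ht)
  refine h1.trans ?_
  calc _ ≤ ∑' C : Ctx n c, g C.1 * wX C := by
        refine ENNReal.tsum_le_tsum fun C => ?_
        rw [mul_comm]; gcongr; exact mu_le C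
    _ = _ := by
        rw [ctx_left g, tsum_head (fun a => isLeafB a = false) g (fun a l => rfl), tsum_nonleaf]

lemma Up_EL (hn : 1 ≤ n) (q : Fin n × Bool) :
    Up n c (EL q) ≤ rE n * wL n c * (rE n * wL n c) := by
  let g : List (Ch n c) → ℝ≥0∞ := fun l => match l with
    | [] => 0
    | a :: _ => ind (a.1 = AT.leaf q.1 q.2)
  have h1 := Up_le_ctx (c := c) hn (EL q) (fun C => g C.1) (by
    rintro ⟨l, r⟩
    match l with
    | [] =>
      refine (Up_mono (T' := ∅) fun t ht => ?_).trans (le_of_eq Up_empty)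
      exfalso
      simp only [tr, EL, plug, List.map_nil, List.nil_append, Set.mem_ofPred_eq] at ht
      have h2 := (hd_some _ _ _).1 ht
      have h3 := nd_notLeaf t
      rw [h2] at h3
      simp [isLeafB] at h3
    | a :: l =>
      by_cases ha : a.1 = AT.leaf q.1 q.2
      · simp only [g]
        rw [ind_pos ha]; exact Up_le_one _
      · refine le_trans (le_of_eq ?_) zero_le
        refine le_antisymm ?_ zero_le
        rw [← Up_empty (n := n) (c := !c)]
        refine Up_mono fun t ht => ?_
        exfalso; apply ha
        simp only [tr, EL, plug, List.map_cons, List.cons_append, Set.mem_ofPred_eq] at ht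
        exact (hd_some _ _ _).1 ht)
  refine h1.trans ?_
  calc _ ≤ ∑' C : Ctx n c, g C.1 * wX C := by
        refine ENNReal.tsum_le_tsum fun C => ?_
        rw [mul_comm]; gcongr; exact mu_le C
    _ = _ := by
        rw [ctx_left g, tsum_head (fun a => a = AT.leaf q.1 q.2) g (fun a l => rfl), tsum_lf]
        simp [g]

lemma Up_taut_true (hn : 1 ≤ n) :
    Up n true (Taut n) ≤ rE n * wL n true * (1 + wN n false * wL n true) := by
  refine le_trans (Up_mono fun t ht => ?_) (Up_E0 hn)
  by_contra hcon
  obtain ⟨⟨i, b⟩, hp⟩ := Option.ne_none_iff_exists'.1 hcon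
  obtain ⟨t, h1, h2⟩ := t
  cases t with
  | leaf i b => simp [rootConn] at h2
  | node c ts =>
    simp only [rootConn, Option.some.injEq] at h2
    subst h2
    have := congrFun ht (fun _ => !b)
    rw [hd_false hp rfl] at this
    simp at this

lemma nd_first (F p : AT n → Prop) (h : ∀ a ts, F (.node c (a :: ts)) ↔ p a) :
    ∑' t : Nd n c, ind (F t.1) * rE n ^ size t.1 =
      rE n * (∑' a : Ch n c, ind (p a.1) * rE n ^ size a.1) * (wC n c * wL n c) := by
  rw [tsum_nd (fun t => ind (F t) * rE n ^ size t)]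
  have : ∀ (a b : Ch n c) (l : List (Ch n c)),
      ind (F (AT.node c (a.1 :: b.1 :: l.map Subtype.val))) *
      rE n ^ (size (AT.node c (a.1 :: b.1 :: l.map Subtype.val))) =
      rE n * ((ind (p a.1) * rE n ^ size a.1) * (rE n ^ size b.1 * rE n ^ ls l)) := by
    intro a b l
    rw [show ind (F (AT.node c (a.1 :: b.1 :: l.map Subtype.val))) = ind (p a.1) by
      congr 1; exact propext (h _ _)]
    simp only [size, sizeList, ls, pow_add, pow_one]; ring
  simp_rw [this, ENNReal.tsum_mul_left, ENNReal.tsum_mul_right]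
  rw [← wC, ← wL]
  ring

lemma wC_le (hn : 1 ≤ n) : wC n c ≤ 1 := by
  have := srt_ge hn
  rw [wC_val hn, ← ENNReal.ofReal_one]
  apply ENNReal.ofReal_le_ofReal
  rw [div_le_one (by positivity)]; linarith

lemma nd_first_le (hn : 1 ≤ n) (F p : AT n → Prop) (h : ∀ a ts, F (.node c (a :: ts)) ↔ p a) :
    ∑' t : Nd n c, ind (F t.1) * rE n ^ size t.1 ≤
      rE n * (∑' a : Ch n c, ind (p a.1) * rE n ^ size a.1) * wL n c := by
  rw [nd_first F p h]
  gcongr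
  exact mul_le_of_le_one_left zero_le (wC_le hn)

lemma wP_bad1 (hn : 1 ≤ n) : wP (bad1 (n := n)) ≤ rE n * wN n false * wL n true := by
  have e : wP (bad1 (n := n)) = ∑' u : Ch n false,
    (fun t => ind (isLeafB t = false ∧ hd t = none) * rE n ^ size t) u.1 := rfl
  rw [e, tsum_ch (fun t => ind (isLeafB t = false ∧ hd t = none) * rE n ^ size t)]
  have h1 : ∑' p : Fin n × Bool, ind (isLeafB (AT.leaf p.1 p.2) = false ∧
      hd (AT.leaf p.1 p.2) = none) * rE n ^ size (AT.leaf p.1 p.2) = 0 := by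
    rw [ENNReal.tsum_eq_zero]
    intro p
    rw [ind_neg (by simp [isLeafB]), zero_mul]
  rw [h1, zero_add]
  have := nd_first_le (n := n) (c := true) hn (fun t => isLeafB t = false ∧ hd t = none)
    (fun a => isLeafB a = false) (by
      intro a ts
      rw [hd_none]; simp [isLeafB])
  rwa [tsum_nonleaf] at this

lemma sum_nl (hn : 1 ≤ n) (q : Fin n × Bool) :
    ∑' u : Ch n false, ind (isLeafB u.1 = false ∧ fl u.1 = some q) * rE n ^ size u.1 ≤
      rE n * rE n * wL n true := by
  rw [tsum_ch (fun t => ind (isLeafB t = false ∧ fl t = some q) * rE n ^ size t)]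
  have h1 : ∑' p : Fin n × Bool, ind (isLeafB (AT.leaf p.1 p.2) = false ∧
      fl (AT.leaf p.1 p.2) = some q) * rE n ^ size (AT.leaf p.1 p.2) = 0 := by
    rw [ENNReal.tsum_eq_zero]
    intro p
    rw [ind_neg (by simp [isLeafB]), zero_mul]
  rw [h1, zero_add]
  have := nd_first_le (n := n) (c := true) hn (fun t => isLeafB t = false ∧ fl t = some q)
    (fun a => a = AT.leaf q.1 q.2) (by
      intro a ts
      rw [fl, hd_some]; simp [isLeafB])
  rwa [tsum_lf] at this

lemma wP_fl (hn : 1 ≤ n) (q : Fin n × Bool) :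
    wP (fun u : Ch n false => fl u.1 = some q) ≤ rE n + rE n * rE n * wL n true := by
  refine le_trans ?_ (add_le_add (le_of_eq (tsum_lf (n := n) (c := false) q)) (sum_nl hn q))
  rw [wP, ← ENNReal.tsum_add]
  refine ENNReal.tsum_le_tsum fun u => ?_
  rw [← add_mul]
  refine mul_le_mul_left (le_trans (ind_mono ?_) (ind_or _ _)) _
  intro h
  cases hl : isLeafB u.1
  · right; exact ⟨rfl, h⟩
  · left; exact fl_leaf h hl

lemma tsum_lit (a : ℝ≥0∞) : ∑' _ : Fin n × Bool, a = 2 * n * a := by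
  rw [tsum_fintype]; simp; ring

lemma wR_bad2 (hn : 1 ≤ n) : wR (bad2 (n := n)) ≤
    2 * n * ((rE n * rE n * wL n true) * (rE n + rE n * rE n * wL n true)) := by
  rw [← tsum_lit]
  calc wR (bad2 (n := n)) ≤ ∑' u : Ch n false, ∑' v : Ch n false, ∑' q : Fin n × Bool,
        (ind (isLeafB u.1 = false ∧ fl u.1 = some q) * rE n ^ size u.1) *
        (ind (fl v.1 = some (cmpl q)) * rE n ^ size v.1) := by
        refine ENNReal.tsum_le_tsum fun u => ENNReal.tsum_le_tsum fun v => ?_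
        by_cases h : bad2 u v
        · obtain ⟨hl, q, h1, h2⟩ := h
          refine le_trans ?_ (ENNReal.le_tsum q)
          have e1 : ind (isLeafB u.1 = false ∧ fl u.1 = some q) = 1 := ind_pos ⟨hl, h1⟩
          have e2 : ind (bad2 u v) = 1 := ind_pos ⟨hl, q, h1, h2⟩
          rw [e1, e2, ind_pos h2]
          simp only [one_mul]
          exact le_rfl
        · rw [ind_neg h, zero_mul]; exact zero_le
    _ = ∑' q : Fin n × Bool,
        (∑' u : Ch n false, ind (isLeafB u.1 = false ∧ fl u.1 = some q) * rE n ^ size u.1) *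
        wP (fun v : Ch n false => fl v.1 = some (cmpl q)) := by
        have : ∀ u : Ch n false, ∑' v : Ch n false, ∑' q : Fin n × Bool,
          (ind (isLeafB u.1 = false ∧ fl u.1 = some q) * rE n ^ size u.1) *
          (ind (fl v.1 = some (cmpl q)) * rE n ^ size v.1) =
          ∑' q : Fin n × Bool, (ind (isLeafB u.1 = false ∧ fl u.1 = some q) * rE n ^ size u.1) *
            wP (fun v : Ch n false => fl v.1 = some (cmpl q)) := by
          intro u
          rw [ENNReal.tsum_comm]
          simp_rw [ENNReal.tsum_mul_left]
          rfl
        simp_rw [this]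
        rw [ENNReal.tsum_comm]
        simp_rw [ENNReal.tsum_mul_right]
    _ ≤ _ := by
        refine ENNReal.tsum_le_tsum fun q => ?_
        exact mul_le_mul' (sum_nl hn q) (wP_fl hn (cmpl q))

lemma Up_finset {ι : Type*} (s : Finset ι) (F : ι → Set (AT n)) :
    Up n c {t | ∃ q ∈ s, t ∈ F q} ≤ ∑ q ∈ s, Up n c (F q) := by
  classical
  induction s using Finset.induction_on with
  | empty =>
    simp only [Finset.sum_empty]
    rw [← Up_empty (n := n) (c := c)]
    exact Up_mono fun t ht => by simp at ht
  | insert a s ha ih =>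
    rw [Finset.sum_insert ha]
    refine le_trans (le_trans (Up_mono fun t ht => ?_) (Up_union (F a) {t | ∃ q ∈ s, t ∈ F q}))
      (add_le_add le_rfl ih)
    obtain ⟨q, hq, h⟩ := ht
    rcases Finset.mem_insert.1 hq with rfl | hq
    · exact Or.inl h
    · exact Or.inr ⟨q, hq, h⟩

lemma Up_ctx_taut (C : Ctx n false) :
    Up n true (tr (Taut n \ SimpleTauto n) C) ≤
      ind (∃ u ∈ C.1 ++ C.2, bad1 u) + ind (∃ u ∈ C.1 ++ C.2, ∃ v ∈ C.1 ++ C.2, bad2 u v) +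
      Up n true (E0 n) +
      ∑' q : Fin n × Bool, ind (∃ u ∈ C.1 ++ C.2, fl u.1 = some q) * Up n true (EL (cmpl q)) := by
  by_cases h1 : ∃ u ∈ C.1 ++ C.2, bad1 u
  · rw [ind_pos h1, add_assoc, add_assoc]
    exact (Up_le_one _).trans le_self_add
  by_cases h2 : ∃ u ∈ C.1 ++ C.2, ∃ v ∈ C.1 ++ C.2, bad2 u v
  · rw [ind_pos h2, add_comm (ind _), add_assoc, add_assoc]
    exact (Up_le_one _).trans le_self_add
  rw [ind_neg h1, ind_neg h2, zero_add, zero_add]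
  have h3 := Up_finset (n := n) (c := true) Finset.univ (fun q : Fin n × Bool =>
    {t | (∃ u ∈ C.1 ++ C.2, fl u.1 = some q) ∧ hd t = some (cmpl q)})
  refine le_trans (le_trans (Up_mono fun t ht => ?_) (Up_union (E0 n) _))
    (add_le_add le_rfl (h3.trans ?_))
  · rcases taut_cases C t ht h1 h2 with h | ⟨q, h, h'⟩
    · exact Or.inl h
    · exact Or.inr ⟨q, Finset.mem_univ _, h, h'⟩
  · rw [tsum_fintype]
    refine Finset.sum_le_sum fun q _ => ?_
    by_cases h : ∃ u ∈ C.1 ++ C.2, fl u.1 = some q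
    · rw [ind_pos h, one_mul]
      exact Up_mono fun t ht => ht.2
    · rw [ind_neg h, zero_mul, ← Up_empty (n := n) (c := true)]
      exact Up_mono fun t ht => (h ht.1).elim

lemma wL_indep (c d : Bool) : wL n c = wL n d := by rw [wL_geom, wL_geom, wC_indep c d]

lemma Up_taut_false (hn : 1 ≤ n) :
    Up n false (Taut n \ SimpleTauto n) ≤
      2 * (rE n * wL n true ^ 3 * (rE n * wN n false * wL n true)) +
      6 * (rE n * wL n true ^ 4 * (2 * n * ((rE n * rE n * wL n true) *
        (rE n + rE n * rE n * wL n true)))) +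
      rE n * wL n true * (1 + wN n false * wL n true) +
      2 * n * (2 * (rE n * wL n true ^ 3 * (rE n + rE n * rE n * wL n true)) *
        (rE n * wL n true * (rE n * wL n true))) := by
  refine (Up_le_ctx hn _ _ Up_ctx_taut).trans ?_
  simp only [mul_add]
  rw [ENNReal.tsum_add, ENNReal.tsum_add, ENNReal.tsum_add]
  refine add_le_add (add_le_add (add_le_add ?_ ?_) ?_) ?_
  · refine le_trans (ENNReal.tsum_le_tsum fun C => ?_)
      (le_trans (ctx_mem (c := false) (bad1 (n := n))) ?_)
    · rw [mul_comm]; gcongr; exact mu_le C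
    · rw [wL_indep false true]
      gcongr; exact wP_bad1 hn
  · refine le_trans (ENNReal.tsum_le_tsum fun C => ?_)
      (le_trans (ctx_pair (c := false) (bad2 (n := n)) bad2_irrefl) ?_)
    · rw [mul_comm]; gcongr; exact mu_le C
    · rw [wL_indep false true]
      simp only [← mul_add]
      gcongr; exact wR_bad2 hn
  · rw [ENNReal.tsum_mul_right, tsum_mu hn, one_mul]
    simp only [← mul_add]
    exact Up_E0 hn
  · simp only [← mul_add]
    calc _ ≤ ∑' C : Ctx n false, ∑' q : Fin n × Bool,
          (ind (∃ u ∈ C.1 ++ C.2, fl u.1 = some q) * wX C) *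
            (rE n * wL n true * (rE n * wL n true)) := by
          refine ENNReal.tsum_le_tsum fun C => ?_
          rw [← ENNReal.tsum_mul_left]
          refine ENNReal.tsum_le_tsum fun q => ?_
          calc _ ≤ wX C * (ind (∃ u ∈ C.1 ++ C.2, fl u.1 = some q) *
              (rE n * wL n true * (rE n * wL n true))) :=
                mul_le_mul' (mu_le C) (mul_le_mul' le_rfl (Up_EL hn _))
            _ = _ := by ring
      _ = ∑' q : Fin n × Bool, (∑' C : Ctx n false,
          (ind (∃ u ∈ C.1 ++ C.2, fl u.1 = some q) * wX C)) *
            (rE n * wL n true * (rE n * wL n true)) := by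
          rw [ENNReal.tsum_comm]
          simp_rw [ENNReal.tsum_mul_right]
      _ ≤ ∑' q : Fin n × Bool, 2 * (rE n * wL n true ^ 3 * (rE n + rE n * rE n * wL n true)) *
            (rE n * wL n true * (rE n * wL n true)) := by
          refine ENNReal.tsum_le_tsum fun q => mul_le_mul' ?_ le_rfl
          refine (ctx_mem (c := false) (fun u : Ch n false => fl u.1 = some q)).trans ?_
          rw [wL_indep false true]
          gcongr
          exact wP_fl hn q
      _ = _ := by
          rw [tsum_lit]

lemma final_bound (hn : 1 ≤ n) :
    (Up n true (Taut n) + Up n false (Taut n \ SimpleTauto n)).toReal ≤ 1000 / srt n := by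
  have hs := srt_ge hn
  have hs0 : 0 < srt n := by linarith
  set x : ℝ≥0∞ := ENNReal.ofReal (srt n) with hx
  set i : ℝ≥0∞ := ENNReal.ofReal (srt n)⁻¹ with hi
  have hxi : x * i = 1 := by
    rw [hx, hi, ← ENNReal.ofReal_mul hs0.le, mul_inv_cancel₀ hs0.ne', ENNReal.ofReal_one]
  have hi1 : i ≤ 1 := by
    rw [hi, ← ENNReal.ofReal_one]
    exact ENNReal.ofReal_le_ofReal (inv_le_one_of_one_le₀ hs)
  have hr : rE n ≤ i ^ 2 := by
    rw [rE, hi, ← ENNReal.ofReal_pow (by positivity)]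
    apply ENNReal.ofReal_le_ofReal
    rw [rho, inv_pow, one_div]
    apply inv_anti₀ (by positivity)
    nlinarith
  have hL : wL n true ≤ 2 * x := by
    rw [wL_val hn, hx, show (2:ℝ≥0∞) = ENNReal.ofReal 2 by simp, ← ENNReal.ofReal_mul (by norm_num)]
    apply ENNReal.ofReal_le_ofReal
    linarith
  have hN : wN n false ≤ i := by
    rw [wN_val hn, hi]
    apply ENNReal.ofReal_le_ofReal
    rw [div_le_iff₀ (by positivity), inv_mul_eq_div, le_div_iff₀ hs0]
    nlinarith
  have hn2 : 2 * (n:ℝ≥0∞) = x ^ 2 := by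
    rw [hx, ← ENNReal.ofReal_pow hs0.le, pow_two, srt_srt, ENNReal.ofReal_mul (by norm_num)]
    simp
  have hk : rE n + rE n * rE n * wL n true ≤ 3 * i ^ 2 := by
    calc _ ≤ i ^ 2 + i ^ 2 * i ^ 2 * (2 * x) := by gcongr
      _ = i ^ 2 + 2 * i ^ 3 * (x * i) := by ring
      _ = i ^ 2 + 2 * i ^ 2 * i := by rw [hxi]; ring
      _ ≤ i ^ 2 + 2 * i ^ 2 * 1 := by gcongr
      _ = _ := by ring
  have hE : rE n * wL n true * (1 + wN n false * wL n true) ≤ 6 * i := by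
    calc _ ≤ i ^ 2 * (2 * x) * (1 + i * (2 * x)) := by gcongr
      _ = 2 * i * (x * i) * (1 + 2 * (x * i)) := by ring
      _ = 6 * i := by rw [hxi]; ring
  have h1 := Up_taut_true (n := n) hn
  have h2 := Up_taut_false (n := n) hn
  have hT1 : 2 * (rE n * wL n true ^ 3 * (rE n * wN n false * wL n true)) ≤ 32 * i := by
    calc _ ≤ 2 * (i ^ 2 * (2 * x) ^ 3 * (i ^ 2 * i * (2 * x))) := by gcongr
      _ = 32 * i * (x * i) ^ 4 := by ring
      _ = _ := by rw [hxi]; ring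
  have hT2 : 6 * (rE n * wL n true ^ 4 * (2 * n * ((rE n * rE n * wL n true) *
        (rE n + rE n * rE n * wL n true)))) ≤ 576 * i := by
    rw [hn2]
    calc _ ≤ 6 * (i ^ 2 * (2 * x) ^ 4 * (x ^ 2 * ((i ^ 2 * i ^ 2 * (2 * x)) * (3 * i ^ 2)))) := by
          gcongr
      _ = 576 * i * (x * i) ^ 7 := by ring
      _ = _ := by rw [hxi]; ring
  have hT4 : 2 * n * (2 * (rE n * wL n true ^ 3 * (rE n + rE n * rE n * wL n true)) *
        (rE n * wL n true * (rE n * wL n true))) ≤ 192 * i := by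
    rw [hn2]
    calc _ ≤ x ^ 2 * (2 * (i ^ 2 * (2 * x) ^ 3 * (3 * i ^ 2)) *
          (i ^ 2 * (2 * x) * (i ^ 2 * (2 * x)))) := by
          gcongr
      _ = 192 * i * (x * i) ^ 7 := by ring
      _ = _ := by rw [hxi]; ring
  have hall : Up n true (Taut n) + Up n false (Taut n \ SimpleTauto n) ≤ 1000 * i := by
    calc _ ≤ 6 * i + (32 * i + 576 * i + 6 * i + 192 * i) :=
          add_le_add (h1.trans hE) (h2.trans (add_le_add (add_le_add (add_le_add hT1 hT2) hE) hT4))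
      _ = 812 * i := by ring
      _ ≤ 1000 * i := by gcongr; norm_num
  have := ENNReal.toReal_mono (ENNReal.mul_ne_top (by simp) ENNReal.ofReal_ne_top) hall
  rw [ENNReal.toReal_mul, ENNReal.toReal_ofReal (by positivity)] at this
  rw [div_eq_mul_inv]
  simpa using this

lemma countIn_zero (T : Set (AT 0)) (m : ℕ) : countIn 0 T m = 0 := by
  have key : ∀ t : AT 0, WF t → False := by
    intro t ht
    induction ht with
    | leaf i b => exact i.elim0
    | node c ts h1 h2 h3 ih =>
      match ts, h1 with
      | a :: ts, _ => exact ih a (by simp)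
  rw [countIn]
  have : IsEmpty {t : AT 0 // t ∈ T ∧ WF t ∧ size t = m} := ⟨fun t => key t.1 t.2.2.1⟩
  simp

end bounds



end part8

open Filter in
/-- Asymptotically almost every tautology is a simple tautology: for every `n` the
limits `P_n(True)` and `μ_n(S_n)` exist, and their difference tends to `0` as
`n → ∞`. -/
theorem statement14 :
    ∃ p μ : ℕ → ℝ,
      (∀ n : ℕ,
        Tendsto (fun m => Pmn n m (fun _ => true)) atTop (nhds (p n)) ∧
        HasLimRatio n (SimpleTauto n) (μ n)) ∧
      Tendsto (fun n : ℕ => p n - μ n) atTop (nhds 0) := by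
  refine ⟨fun n => if n = 0 then 0 else ((Up n true (Taut n) + Up n false (Taut n)) / 2).toReal,
    fun n => if n = 0 then 0 else
      ((Up n true (SimpleTauto n) + Up n false (SimpleTauto n)) / 2).toReal, ?_, ?_⟩
  · intro n
    by_cases hn : n = 0
    · subst hn
      have h : ∀ T : Set (AT 0), ratio 0 T = fun _ => 0 := by
        intro T; funext m
        rw [ratio, countIn_zero]; simp
      have h' : (fun m => Pmn 0 m (fun _ => true)) = ratio 0 (Taut 0) := rfl
      rw [h', HasLimRatio, h, h]
      simp
    · have hn1 : 1 ≤ n := by omega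
      simp only [if_neg hn]
      exact ⟨ratio_tendsto (Taut n) (osc_taut hn1), ratio_tendsto _ (osc_simple hn1)⟩
  · apply squeeze_zero_norm' (a := fun n : ℕ => 1000 / srt n)
    · filter_upwards [eventually_ge_atTop 1] with n hn
      have hn0 : n ≠ 0 := by omega
      simp only [if_neg hn0, Real.norm_eq_abs]
      exact diff_bound.trans (final_bound hn)
    · apply Tendsto.div_atTop tendsto_const_nhds
      unfold srt
      refine Real.tendsto_sqrt_atTop.comp ?_
      exact Tendsto.const_mul_atTop (by norm_num) tendsto_natCast_atTop_atTop
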